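/- arXiv:1008.2275 — 7 statements merged into one kernel-verified Lean document; each statement's English description precedes it below -/
import Mathlib

section
/- For every bounded operator A on h⊗H and all u, v ∈ h, the operator inequalities 0 ≤ A(u,v)*·A(u,v) ≤ ‖u‖²·(A*A)(v,v) hold in B(H) (in the sense of positive operators). -/
/- STATEMENT 4: 0 ≤ A(u,v)*·A(u,v) ≤ ‖u‖²·(A*A)(v,v) as positive operators on H. -/

local notation "⟪" x ", " y "⟫" => @inner ℂ _ _ x y

theorem norm_bilin_eq_norm_mul_norm
    {h H E : Type*}
    [NormedAddCommGroup h] [InnerProductSpace ℂ h]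
    [NormedAddCommGroup H] [InnerProductSpace ℂ H]
    [NormedAddCommGroup E] [InnerProductSpace ℂ E]
    (tp : h →ₗ[ℂ] H →ₗ[ℂ] E)
    (htp : ∀ (u v : h) (ξ η : H), ⟪tp u ξ, tp v η⟫ = ⟪u, v⟫ * ⟪ξ, η⟫)
    (u : h) (ξ : H) : ‖tp u ξ‖ = ‖u‖ * ‖ξ‖ := by
  have hsq := htp u u ξ ξ
  simp only [inner_self_eq_norm_sq_to_K] at hsq
  rw [← mul_pow] at hsq
  exact (pow_left_inj₀ (norm_nonneg _) (by positivity) two_ne_zero).mp (by exact_mod_cast hsq)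

theorem norm_apply_le_of_inner_eq
    {h H E : Type*}
    [NormedAddCommGroup h] [InnerProductSpace ℂ h]
    [NormedAddCommGroup H] [InnerProductSpace ℂ H]
    [NormedAddCommGroup E] [InnerProductSpace ℂ E]
    (tp : h →ₗ[ℂ] H →ₗ[ℂ] E)
    (htp : ∀ (u v : h) (ξ η : H), ⟪tp u ξ, tp v η⟫ = ⟪u, v⟫ * ⟪ξ, η⟫)
    (u : h) (ζ : H) (x : E) (hζ : ∀ ξ : H, ⟪ξ, ζ⟫ = ⟪tp u ξ, x⟫) :
    ‖ζ‖ ≤ ‖u‖ * ‖x‖ := by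
  rcases (norm_nonneg ζ).eq_or_lt with h0 | hpos
  · rw [← h0]
    positivity
  · refine le_of_mul_le_mul_left ?_ hpos
    calc ‖ζ‖ * ‖ζ‖ = ‖⟪ζ, ζ⟫‖ := by simp [inner_self_eq_norm_sq_to_K, sq]
      _ = ‖⟪tp u ζ, x⟫‖ := by rw [hζ]
      _ ≤ ‖tp u ζ‖ * ‖x‖ := norm_inner_le_norm _ _
      _ = ‖ζ‖ * (‖u‖ * ‖x‖) := by rw [norm_bilin_eq_norm_mul_norm tp htp]; ring

theorem stmt4
    {h H E : Type*}
    [NormedAddCommGroup h] [InnerProductSpace ℂ h] [CompleteSpace h]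
    [TopologicalSpace.SeparableSpace h]
    [NormedAddCommGroup H] [InnerProductSpace ℂ H] [CompleteSpace H]
    [TopologicalSpace.SeparableSpace H]
    [NormedAddCommGroup E] [InnerProductSpace ℂ E] [CompleteSpace E]
    (tp : h →ₗ[ℂ] H →ₗ[ℂ] E)
    (htp : ∀ (u v : h) (ξ η : H), ⟪tp u ξ, tp v η⟫ = ⟪u, v⟫ * ⟪ξ, η⟫)
    (hdense : Dense (↑(Submodule.span ℂ (Set.range fun p : h × H => tp p.1 p.2)) : Set E))
    (op : (E →L[ℂ] E) → h → h → (H →L[ℂ] H))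
    (hop : ∀ (M : E →L[ℂ] E) (u v : h) (ξ₁ ξ₂ : H),
      ⟪ξ₁, op M u v ξ₂⟫ = ⟪tp u ξ₁, M (tp v ξ₂)⟫)
    (A : E →L[ℂ] E) (u v : h) :
    (ContinuousLinearMap.adjoint (op A u v) ∘L op A u v).IsPositive ∧
    (((‖u‖ : ℂ) ^ 2) • op (ContinuousLinearMap.adjoint A ∘L A) v v
      - ContinuousLinearMap.adjoint (op A u v) ∘L op A u v).IsPositive := by
  set B := op A u v
  refine ⟨ContinuousLinearMap.isPositive_adjoint_comp_self B, ?_⟩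
  rw [ContinuousLinearMap.isPositive_iff_complex]
  intro ξ
  have hquad : ⟪op (ContinuousLinearMap.adjoint A ∘L A) v v ξ, ξ⟫
      = ((‖A (tp v ξ)‖ ^ 2 : ℝ) : ℂ) := by
    rw [← inner_conj_symm, hop]
    simp [ContinuousLinearMap.adjoint_inner_right, inner_self_eq_norm_sq_to_K]
  have hval : ⟪(((‖u‖ : ℂ) ^ 2) • op (ContinuousLinearMap.adjoint A ∘L A) v v
      - ContinuousLinearMap.adjoint B ∘L B) ξ, ξ⟫
      = (((‖u‖ * ‖A (tp v ξ)‖) ^ 2 - ‖B ξ‖ ^ 2 : ℝ) : ℂ) := by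
    rw [sub_apply, smul_apply, inner_sub_left,
      inner_smul_left, hquad, ContinuousLinearMap.comp_apply,
      ContinuousLinearMap.adjoint_inner_left, inner_self_eq_norm_sq_to_K]
    simp [mul_pow]
  rw [hval]
  refine ⟨by rw [RCLike.re_eq_complex_re, Complex.ofReal_re], ?_⟩
  have hle : ‖B ξ‖ ≤ ‖u‖ * ‖A (tp v ξ)‖ :=
    norm_apply_le_of_inner_eq tp htp u (B ξ) (A (tp v ξ)) fun η => hop A u v η ξ
  rw [RCLike.re_eq_complex_re, Complex.ofReal_re]
  exact sub_nonneg.mpr (pow_le_pow_left₀ (norm_nonneg _) hle 2)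
end

section
/- Let U be a unitary operator on h⊗H, Ω ∈ H a unit vector, and T := T_U the vacuum expectation of U. Then for every orthonormal basis {φ_k : k ≥ 1} of h and every w ∈ h, Σ_{k≥1} ‖(U−1)(φ_k,w)Ω‖² = ⟨w,(1−T)w⟩ + ⟨(1−T)w,w⟩ (in particular the series converges and equals 2·Re⟨w,(1−T)w⟩). -/
/- STATEMENT 6: For a unitary U on h⊗H, a unit vector Ω ∈ H and the vacuum
expectation T (⟨u,Tv⟩ = ⟨u⊗Ω, U(v⊗Ω)⟩), for any orthonormal basis {φ_k} of h
and w ∈ h:  Σ_k ‖(U−1)(φ_k,w)Ω‖² = ⟨w,(1−T)w⟩ + ⟨(1−T)w,w⟩ = 2 Re⟨w,(1−T)w⟩. -/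

local notation "⟪" x ", " y "⟫" => @inner ℂ _ _ x y

/-- Parseval's identity for the squared norm. -/
theorem HilbertBasis.hasSum_norm_inner_sq {ι F : Type*} [NormedAddCommGroup F]
    [InnerProductSpace ℂ F] (b : HilbertBasis ι ℂ F) (x : F) :
    HasSum (fun i => ((‖⟪b i, x⟫‖ ^ 2 : ℝ) : ℂ)) ((‖x‖ ^ 2 : ℝ) : ℂ) := by
  have hcoeff (i : ι) : ((‖⟪b i, x⟫‖ ^ 2 : ℝ) : ℂ) = ⟪x, b i⟫ * ⟪b i, x⟫ := by
    rw [← inner_conj_symm x (b i), RCLike.conj_mul]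
    exact Complex.ofReal_pow _ _
  have hself : ((‖x‖ ^ 2 : ℝ) : ℂ) = ⟪x, x⟫ := by
    rw [inner_self_eq_norm_sq_to_K]
    exact Complex.ofReal_pow _ _
  simp only [hcoeff, hself]
  exact b.hasSum_inner_mul_inner x x

section TensorModel

variable {h H E : Type*}
  [NormedAddCommGroup h] [InnerProductSpace ℂ h]
  [NormedAddCommGroup H] [InnerProductSpace ℂ H]
  [NormedAddCommGroup E] [InnerProductSpace ℂ E]

theorem norm_tensor_eq_mul_norm (tp : h →ₗ[ℂ] H →ₗ[ℂ] E)
    (htp : ∀ (u v : h) (ξ η : H), ⟪tp u ξ, tp v η⟫ = ⟪u, v⟫ * ⟪ξ, η⟫) (u : h) (ξ : H) :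
    ‖tp u ξ‖ = ‖u‖ * ‖ξ‖ := by
  have key := htp u u ξ ξ
  simp only [inner_self_eq_norm_sq_to_K] at key
  rw [← mul_pow] at key
  norm_cast at key
  exact (pow_left_inj₀ (norm_nonneg _) (by positivity) two_ne_zero).1 (by exact_mod_cast key)

theorem orthonormal_tensor {ι κ : Type*} (tp : h →ₗ[ℂ] H →ₗ[ℂ] E)
    (htp : ∀ (u v : h) (ξ η : H), ⟪tp u ξ, tp v η⟫ = ⟪u, v⟫ * ⟪ξ, η⟫)
    {a : ι → h} (ha : Orthonormal ℂ a) {b : κ → H} (hb : Orthonormal ℂ b) :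
    Orthonormal ℂ (fun p : ι × κ => tp (a p.1) (b p.2)) := by
  classical
  rw [orthonormal_iff_ite] at *
  rintro ⟨i, j⟩ ⟨i', j'⟩
  rw [htp, ha, hb]
  simp only [Prod.mk.injEq]
  split_ifs <;> simp_all

/-- A continuous linear map sending a Hilbert basis into a closed submodule takes all its values
there. -/
theorem HilbertBasis.map_mem_of_isClosed {ι F : Type*} [NormedAddCommGroup F]
    [InnerProductSpace ℂ F] (b : HilbertBasis ι ℂ F) (f : F →L[ℂ] E) {S : Submodule ℂ E}
    (hS : IsClosed (S : Set E)) (hb : ∀ i, f (b i) ∈ S) (x : F) : f x ∈ S := by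
  have hle : (Submodule.span ℂ (Set.range b)).topologicalClosure ≤ S.comap f.toLinearMap := by
    refine Submodule.topologicalClosure_minimal _ ?_ (hS.preimage f.continuous)
    rw [Submodule.span_le]
    rintro _ ⟨i, rfl⟩
    exact hb i
  rw [b.dense_span] at hle
  exact hle Submodule.mem_top

theorem span_tensor_topologicalClosure_eq_top {ι κ : Type*} (tp : h →ₗ[ℂ] H →ₗ[ℂ] E)
    (htp : ∀ (u v : h) (ξ η : H), ⟪tp u ξ, tp v η⟫ = ⟪u, v⟫ * ⟪ξ, η⟫)
    (hdense : Dense (↑(Submodule.span ℂ (Set.range fun p : h × H => tp p.1 p.2)) : Set E))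
    (a : HilbertBasis ι ℂ h) (b : HilbertBasis κ ℂ H) :
    (Submodule.span ℂ
      (Set.range fun p : ι × κ => tp (a p.1) (b p.2))).topologicalClosure = ⊤ := by
  set S := (Submodule.span ℂ
    (Set.range fun p : ι × κ => tp (a p.1) (b p.2))).topologicalClosure with hSdef
  have hS : IsClosed (S : Set E) := Submodule.isClosed_topologicalClosure _
  have hright (i : ι) (ξ : H) : tp (a i) ξ ∈ S := by
    refine b.map_mem_of_isClosed ((tp (a i)).mkContinuous ‖a i‖ fun ξ =>
      (norm_tensor_eq_mul_norm tp htp _ _).le) hS (fun j => ?_) ξ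
    exact Submodule.le_topologicalClosure _ (Submodule.subset_span ⟨(i, j), rfl⟩)
  have hall (u : h) (ξ : H) : tp u ξ ∈ S := by
    refine a.map_mem_of_isClosed ((tp.flip ξ).mkContinuous ‖ξ‖ fun u => ?_) hS
      (fun i => hright i ξ) u
    rw [LinearMap.flip_apply, norm_tensor_eq_mul_norm tp htp, mul_comm]
  rw [eq_top_iff, ← (Submodule.dense_iff_topologicalClosure_eq_top).1 hdense]
  refine Submodule.topologicalClosure_minimal _ ?_ hS
  rw [Submodule.span_le]
  rintro _ ⟨p, rfl⟩
  exact hall p.1 p.2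

/-- If the vectors `y i` represent the functionals `ξ ↦ ⟪tp (a i) ξ, x⟫`, then their squared norms
sum to that of `x`. -/
theorem hasSum_norm_sq_of_inner_eq_tensor [CompleteSpace H] [CompleteSpace E] {ι : Type*}
    (tp : h →ₗ[ℂ] H →ₗ[ℂ] E)
    (htp : ∀ (u v : h) (ξ η : H), ⟪tp u ξ, tp v η⟫ = ⟪u, v⟫ * ⟪ξ, η⟫)
    (hdense : Dense (↑(Submodule.span ℂ (Set.range fun p : h × H => tp p.1 p.2)) : Set E))
    (a : HilbertBasis ι ℂ h) (x : E) (y : ι → H)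
    (hy : ∀ i ξ, ⟪ξ, y i⟫ = ⟪tp (a i) ξ, x⟫) :
    HasSum (fun i => ((‖y i‖ ^ 2 : ℝ) : ℂ)) ((‖x‖ ^ 2 : ℝ) : ℂ) := by
  obtain ⟨s, b, -⟩ := exists_hilbertBasis ℂ H
  let c : HilbertBasis (ι × s) ℂ E :=
    HilbertBasis.mk (orthonormal_tensor tp htp a.orthonormal b.orthonormal)
      (span_tensor_topologicalClosure_eq_top tp htp hdense a b).ge
  refine (c.hasSum_norm_inner_sq x).prod_fiberwise fun i => ?_
  convert b.hasSum_norm_inner_sq (y i) using 4 with j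
  rw [hy, HilbertBasis.coe_mk]

end TensorModel

theorem stmt6
    {h H E : Type*}
    [NormedAddCommGroup h] [InnerProductSpace ℂ h] [CompleteSpace h]
    [TopologicalSpace.SeparableSpace h]
    [NormedAddCommGroup H] [InnerProductSpace ℂ H] [CompleteSpace H]
    [TopologicalSpace.SeparableSpace H]
    [NormedAddCommGroup E] [InnerProductSpace ℂ E] [CompleteSpace E]
    (tp : h →ₗ[ℂ] H →ₗ[ℂ] E)
    (htp : ∀ (u v : h) (ξ η : H), ⟪tp u ξ, tp v η⟫ = ⟪u, v⟫ * ⟪ξ, η⟫)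
    (hdense : Dense (↑(Submodule.span ℂ (Set.range fun p : h × H => tp p.1 p.2)) : Set E))
    (op : (E →L[ℂ] E) → h → h → (H →L[ℂ] H))
    (hop : ∀ (M : E →L[ℂ] E) (u v : h) (ξ₁ ξ₂ : H),
      ⟪ξ₁, op M u v ξ₂⟫ = ⟪tp u ξ₁, M (tp v ξ₂)⟫)
    (U : E →L[ℂ] E) (hU : U ∈ unitary (E →L[ℂ] E))
    (Ω : H) (hΩ : ‖Ω‖ = 1)
    (T : h →L[ℂ] h)
    (hT : ∀ u v : h, ⟪u, T v⟫ = ⟪tp u Ω, U (tp v Ω)⟫)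
    (φ : HilbertBasis ℕ ℂ h) (w : h) :
    HasSum (fun k : ℕ => ((‖op (U - 1) (φ k) w Ω‖ ^ 2 : ℝ) : ℂ))
        (⟪w, (1 - T) w⟫ + ⟪(1 - T) w, w⟫) ∧
    ⟪w, (1 - T) w⟫ + ⟪(1 - T) w, w⟫ = 2 * ((⟪w, (1 - T) w⟫).re : ℂ) := by
  have hsymm : ⟪w, (1 - T) w⟫ + ⟪(1 - T) w, w⟫ = 2 * ((⟪w, (1 - T) w⟫).re : ℂ) := by
    rw [← inner_conj_symm ((1 - T) w) w, Complex.add_conj]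
    push_cast
    rfl
  refine ⟨?_, hsymm⟩
  have hsum := hasSum_norm_sq_of_inner_eq_tensor tp htp hdense φ ((U - 1) (tp w Ω))
    (fun k => op (U - 1) (φ k) w Ω) (fun k ξ => hop _ _ _ _ _)
  have hUnorm : ‖U (tp w Ω)‖ = ‖tp w Ω‖ := ContinuousLinearMap.norm_map_of_mem_unitary hU _
  have hnorm : ‖tp w Ω‖ = ‖w‖ := by rw [norm_tensor_eq_mul_norm tp htp, hΩ, mul_one]
  have hval : ‖(U - 1) (tp w Ω)‖ ^ 2 = 2 * (⟪w, (1 - T) w⟫).re := by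
    have hre : (⟪U (tp w Ω), tp w Ω⟫).re = (⟪w, T w⟫).re := by
      rw [hT, ← inner_conj_symm, Complex.conj_re]
    have hself : (⟪w, w⟫).re = ‖w‖ ^ 2 := inner_self_eq_norm_sq (𝕜 := ℂ) w
    have hsub := norm_sub_sq (𝕜 := ℂ) (U (tp w Ω)) (tp w Ω)
    rw [RCLike.re_eq_complex_re, hre, hUnorm, hnorm] at hsub
    simp only [sub_apply, one_apply_eq_self, inner_sub_right,
      Complex.sub_re, hself]
    rw [hsub]
    ring
  rw [hsymm]
  rw [hval] at hsum
  exact_mod_cast hsum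
end

section
/- Let X be a complex separable Banach space and {S_{s,t} : 0 ≤ s ≤ t < ∞} ⊆ B(X) a contractive evolution (‖S_{s,t}‖ ≤ 1, S_{s,s} = 1, S_{r,s}·S_{s,t} = S_{r,t} for r ≤ s ≤ t) with ‖S_{s,t} − 1‖ ≤ C·(t−s) for a constant C. Then the formula (𝒮_t f)(τ) := S_{τ,τ+t} f(τ+t) defines, for each t ≥ 0, a bounded operator 𝒮_t on L¹([0,∞), X) with ‖𝒮_t‖ ≤ 1, and {𝒮_t}_{t≥0} is a strongly continuous one-parameter semigroup: 𝒮_0 = 1, 𝒮_t·𝒮_s = 𝒮_{t+s} for s,t ≥ 0, and ‖𝒮_t f − f‖_{L¹} → 0 as t ↓ 0 for every f ∈ L¹([0,∞), X). -/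
/- STATEMENT 10: For a contractive evolution {S_{s,t}} on a complex separable
Banach space X with ‖S_{s,t} − 1‖ ≤ C(t−s), the formula
(𝒮_t f)(τ) = S_{τ,τ+t} f(τ+t) defines a contraction semigroup on
L¹([0,∞), X), strongly continuous at 0⁺. -/

open MeasureTheory

/-- The left translation `τ ↦ τ + t`, `t ≥ 0`, is nonsingular on the half-line. -/
theorem quasiMeasurePreserving_add_right_Ici {t : ℝ} (ht : 0 ≤ t) :
    Measure.QuasiMeasurePreserving (fun τ : ℝ => τ + t)
      (volume.restrict (Set.Ici 0)) (volume.restrict (Set.Ici 0)) :=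
  (measurePreserving_add_right volume t).quasiMeasurePreserving.restrict
    fun _ hτ => add_nonneg hτ ht

theorem map_add_right_Ici_le {t : ℝ} (ht : 0 ≤ t) :
    (volume.restrict (Set.Ici (0 : ℝ))).map (fun τ => τ + t) ≤
      volume.restrict (Set.Ici 0) := by
  have h := (measurePreserving_add_right (volume : Measure ℝ) t).restrict_preimage
    (measurableSet_Ici (a := t))
  have h' : (fun τ : ℝ => τ + t) ⁻¹' Set.Ici t = Set.Ici 0 := by
    ext τ
    simp
  rw [h'] at h
  rw [h.map_eq]
  exact Measure.restrict_mono (Set.Ici_subset_Ici.2 ht) le_rfl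

theorem eLpNorm_comp_add_right_Ici_le {E : Type*} [NormedAddCommGroup E] {f : ℝ → E} {t : ℝ}
    (ht : 0 ≤ t) (p : ENNReal) (hf : AEStronglyMeasurable f (volume.restrict (Set.Ici 0))) :
    eLpNorm (fun τ => f (τ + t)) p (volume.restrict (Set.Ici 0)) ≤
      eLpNorm f p (volume.restrict (Set.Ici 0)) := by
  have hle := map_add_right_Ici_le ht
  have := eLpNorm_map_measure (p := p) (hf.mono_measure hle)
    (measurable_add_const t).aemeasurable
  exact this.symm.le.trans (eLpNorm_mono_measure f hle)

/-- Translations act continuously on `L¹` of the half-line. -/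
theorem tendsto_integral_norm_comp_add_right_sub {E : Type*} [NormedAddCommGroup E]
    (f : Lp E 1 (volume.restrict (Set.Ici (0 : ℝ)))) :
    Filter.Tendsto
      (fun t => ∫ τ in Set.Ici (0 : ℝ), ‖f (τ + t) - f τ‖) (nhdsWithin 0 (Set.Ioi 0)) (nhds 0) := by
  have hF : MemLp ((Set.Ici (0 : ℝ)).indicator f) 1 volume :=
    (memLp_indicator_iff_restrict measurableSet_Ici).2 (Lp.memLp f)
  let F : Lp E 1 (volume : Measure ℝ) := hF.toLp _
  have : Fact ((1 : ENNReal) ≠ ⊤) := ⟨ENNReal.one_ne_top⟩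
  have hcont : Filter.Tendsto (fun t : ℝ => ‖(DomAddAct.mk t +ᵥ F) - F‖) (nhds 0) (nhds 0) := by
    have : Continuous fun t : ℝ => ‖(DomAddAct.mk t +ᵥ F) - F‖ := by
      have : Continuous fun t : ℝ => DomAddAct.mk t +ᵥ F :=
        DomAddAct.continuous_mk.vadd continuous_const
      fun_prop
    simpa using this.tendsto 0
  refine squeeze_zero' (.of_forall fun t => integral_nonneg fun τ => norm_nonneg _) ?_
    (hcont.mono_left nhdsWithin_le_nhds)
  filter_upwards [self_mem_nhdsWithin] with t (ht : 0 < t)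
  have hae : ∀ᵐ τ ∂(volume : Measure ℝ), τ ∈ Set.Ici (0 : ℝ) →
      ‖f (τ + t) - f τ‖ = ‖((DomAddAct.mk t +ᵥ F) - F : Lp E 1 (volume : Measure ℝ)) τ‖ := by
    filter_upwards [Lp.coeFn_sub (DomAddAct.mk t +ᵥ F) F,
      DomAddAct.vadd_Lp_ae_eq (DomAddAct.mk t) F, hF.coeFn_toLp,
      (measurePreserving_add_left volume t).quasiMeasurePreserving.ae hF.coeFn_toLp]
      with τ h₁ h₂ h₃ h₄ hτ
    have hτt : t + τ ∈ Set.Ici (0 : ℝ) := add_nonneg ht.le (Set.mem_Ici.1 hτ)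
    rw [h₁, Pi.sub_apply, h₂, h₃]
    simp only [Equiv.symm_apply_apply, vadd_eq_add]
    rw [h₄, Set.indicator_of_mem hτt, Set.indicator_of_mem hτ, add_comm]
  rw [setIntegral_congr_ae measurableSet_Ici hae, L1.norm_eq_integral_norm]
  exact setIntegral_le_integral (L1.integrable_coeFn _).norm (.of_forall fun τ => norm_nonneg _)

/-- Along the diagonals `(τ, τ + t)` a Lipschitz contractive evolution is Lipschitz. -/
theorem norm_evolution_sub_le {X : Type*} [NormedAddCommGroup X] [NormedSpace ℂ X]
    {S : ℝ → ℝ → (X →L[ℂ] X)} {C : ℝ}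
    (hcontr : ∀ s t : ℝ, 0 ≤ s → s ≤ t → ‖S s t‖ ≤ 1)
    (hev : ∀ r s t : ℝ, 0 ≤ r → r ≤ s → s ≤ t → S r s * S s t = S r t)
    (hlip : ∀ s t : ℝ, 0 ≤ s → s ≤ t → ‖S s t - 1‖ ≤ C * (t - s))
    {t σ τ : ℝ} (ht : 0 ≤ t) (hσ : 0 ≤ σ) (hστ : σ ≤ τ) :
    ‖S σ (σ + t) - S τ (τ + t)‖ ≤ 2 * C * (τ - σ) := by
  have hC : 0 ≤ C := by simpa using (norm_nonneg _).trans (hlip 0 1 le_rfl zero_le_one)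
  have hτ : 0 ≤ τ := hσ.trans hστ
  rcases le_total τ (σ + t) with h | h
  · have e : S σ (σ + t) - S τ (τ + t) =
        (S σ τ - 1) * S τ (σ + t) - S τ (σ + t) * (S (σ + t) (τ + t) - 1) := by
      rw [← hev σ τ (σ + t) hσ hστ h, ← hev τ (σ + t) (τ + t) hτ h (by linarith)]
      noncomm_ring
    have h₁ := hlip σ τ hσ hστ
    have h₂ := hlip (σ + t) (τ + t) (by linarith) (by linarith)
    have h₃ := hcontr τ (σ + t) hτ h
    have h₄ : ‖(S σ τ - 1) * S τ (σ + t)‖ ≤ C * (τ - σ) :=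
      (norm_mul_le _ _).trans ((mul_le_of_le_one_right (norm_nonneg _) h₃).trans h₁)
    have h₅ : ‖S τ (σ + t) * (S (σ + t) (τ + t) - 1)‖ ≤ C * (τ + t - (σ + t)) :=
      (norm_mul_le _ _).trans ((mul_le_of_le_one_left (norm_nonneg _) h₃).trans h₂)
    rw [e]
    linarith [norm_sub_le ((S σ τ - 1) * S τ (σ + t)) (S τ (σ + t) * (S (σ + t) (τ + t) - 1))]
  · have h₁ := hlip σ (σ + t) hσ (by linarith)
    have h₂ := hlip τ (τ + t) hτ (by linarith)
    have h₃ : C * t ≤ C * (τ - σ) := mul_le_mul_of_nonneg_left (by linarith) hC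
    have e : S σ (σ + t) - S τ (τ + t) = (S σ (σ + t) - 1) - (S τ (τ + t) - 1) := by abel
    rw [e]
    linarith [norm_sub_le (S σ (σ + t) - 1) (S τ (τ + t) - 1)]

theorem continuousOn_evolution {X : Type*} [NormedAddCommGroup X] [NormedSpace ℂ X]
    {S : ℝ → ℝ → (X →L[ℂ] X)} {C : ℝ}
    (hcontr : ∀ s t : ℝ, 0 ≤ s → s ≤ t → ‖S s t‖ ≤ 1)
    (hev : ∀ r s t : ℝ, 0 ≤ r → r ≤ s → s ≤ t → S r s * S s t = S r t)
    (hlip : ∀ s t : ℝ, 0 ≤ s → s ≤ t → ‖S s t - 1‖ ≤ C * (t - s))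
    {t : ℝ} (ht : 0 ≤ t) :
    ContinuousOn (fun τ => S τ (τ + t)) (Set.Ici 0) := by
  refine (LipschitzOnWith.of_dist_le' (K := 2 * C) fun σ hσ τ hτ => ?_).continuousOn
  rw [Real.dist_eq, dist_eq_norm]
  rcases le_total σ τ with h | h
  · rw [abs_sub_comm, abs_of_nonneg (sub_nonneg.2 h)]
    exact norm_evolution_sub_le hcontr hev hlip ht hσ h
  · rw [norm_sub_rev, abs_of_nonneg (sub_nonneg.2 h)]
    exact norm_evolution_sub_le hcontr hev hlip ht hτ h

/-- A strongly measurable family of contractions composed with a left translation defines a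
contraction on `L¹` of the half-line. -/
theorem exists_clm_comp_add_right {X : Type*} [NormedAddCommGroup X] [NormedSpace ℂ X]
    {A : ℝ → X →L[ℂ] X} {t : ℝ} (ht : 0 ≤ t)
    (hA : AEStronglyMeasurable A (volume.restrict (Set.Ici 0)))
    (hA₁ : ∀ τ, 0 ≤ τ → ‖A τ‖ ≤ 1) :
    ∃ T : Lp X 1 (volume.restrict (Set.Ici (0 : ℝ))) →L[ℂ]
        Lp X 1 (volume.restrict (Set.Ici (0 : ℝ))),
      (∀ f : Lp X 1 (volume.restrict (Set.Ici (0 : ℝ))),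
        (T f : ℝ → X) =ᵐ[volume.restrict (Set.Ici (0 : ℝ))] fun τ => A τ (f (τ + t))) ∧
      ‖T‖ ≤ 1 := by
  have hq := quasiMeasurePreserving_add_right_Ici ht
  have hle (f : Lp X 1 (volume.restrict (Set.Ici (0 : ℝ)))) :
      eLpNorm (fun τ => A τ (f (τ + t))) 1 (volume.restrict (Set.Ici 0)) ≤
        eLpNorm f 1 (volume.restrict (Set.Ici 0)) := by
    refine (eLpNorm_mono_ae ?_).trans
      (eLpNorm_comp_add_right_Ici_le ht 1 (Lp.aestronglyMeasurable f))
    filter_upwards [ae_restrict_mem measurableSet_Ici] with τ hτ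
    exact (A τ).le_of_opNorm_le_of_le (hA₁ τ hτ) le_rfl |>.trans_eq (one_mul _)
  have hmem (f : Lp X 1 (volume.restrict (Set.Ici (0 : ℝ)))) :
      MemLp (fun τ => A τ (f (τ + t))) 1 (volume.restrict (Set.Ici 0)) :=
    ⟨isBoundedBilinearMap_apply.continuous.comp_aestronglyMeasurable
      (hA.prodMk ((Lp.aestronglyMeasurable f).comp_quasiMeasurePreserving hq)),
      (hle f).trans_lt (Lp.memLp f).2⟩
  let T : Lp X 1 (volume.restrict (Set.Ici (0 : ℝ))) →ₗ[ℂ]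
      Lp X 1 (volume.restrict (Set.Ici (0 : ℝ))) :=
    { toFun := fun f => (hmem f).toLp _
      map_add' := fun f g => by
        rw [← MemLp.toLp_add, MemLp.toLp_eq_toLp_iff]
        filter_upwards [hq.ae (Lp.coeFn_add f g)] with τ h
        simp only [h, Pi.add_apply, map_add]
      map_smul' := fun c f => by
        rw [RingHom.id_apply, ← MemLp.toLp_const_smul, MemLp.toLp_eq_toLp_iff]
        filter_upwards [hq.ae (Lp.coeFn_smul c f)] with τ h
        simp only [h, Pi.smul_apply, map_smul] }
  refine ⟨T.mkContinuous 1 fun f => ?_, fun f => (hmem f).coeFn_toLp,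
    T.mkContinuous_norm_le zero_le_one _⟩
  rw [one_mul]
  change ‖(hmem f).toLp _‖ ≤ ‖f‖
  rw [Lp.norm_toLp, Lp.norm_def]
  exact ENNReal.toReal_mono (Lp.eLpNorm_ne_top f) (hle f)

theorem stmt10
    {X : Type*} [NormedAddCommGroup X] [NormedSpace ℂ X] [CompleteSpace X]
    [TopologicalSpace.SeparableSpace X]
    (S : ℝ → ℝ → (X →L[ℂ] X)) (C : ℝ)
    (hcontr : ∀ s t : ℝ, 0 ≤ s → s ≤ t → ‖S s t‖ ≤ 1)
    (hid : ∀ s : ℝ, 0 ≤ s → S s s = 1)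
    (hev : ∀ r s t : ℝ, 0 ≤ r → r ≤ s → s ≤ t → S r s * S s t = S r t)
    (hlip : ∀ s t : ℝ, 0 ≤ s → s ≤ t → ‖S s t - 1‖ ≤ C * (t - s)) :
    ∃ 𝒮 : ℝ → (Lp X 1 (volume.restrict (Set.Ici (0 : ℝ)))
                →L[ℂ] Lp X 1 (volume.restrict (Set.Ici (0 : ℝ)))),
      (∀ t : ℝ, 0 ≤ t → ∀ f : Lp X 1 (volume.restrict (Set.Ici (0 : ℝ))),
        (𝒮 t f : ℝ → X) =ᵐ[volume.restrict (Set.Ici (0 : ℝ))]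
          fun τ => S τ (τ + t) ((f : ℝ → X) (τ + t))) ∧
      (∀ t : ℝ, 0 ≤ t → ‖𝒮 t‖ ≤ 1) ∧
      (𝒮 0 = 1) ∧
      (∀ s t : ℝ, 0 ≤ s → 0 ≤ t → 𝒮 t ∘L 𝒮 s = 𝒮 (t + s)) ∧
      (∀ f : Lp X 1 (volume.restrict (Set.Ici (0 : ℝ))),
        Filter.Tendsto (fun t => ‖𝒮 t f - f‖) (nhdsWithin 0 (Set.Ioi 0)) (nhds 0)) := by
  have hex : ∀ t : ℝ, ∃ T : Lp X 1 (volume.restrict (Set.Ici (0 : ℝ))) →L[ℂ]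
      Lp X 1 (volume.restrict (Set.Ici (0 : ℝ))), 0 ≤ t →
      (∀ f : Lp X 1 (volume.restrict (Set.Ici (0 : ℝ))),
        (T f : ℝ → X) =ᵐ[volume.restrict (Set.Ici (0 : ℝ))]
          fun τ => S τ (τ + t) (f (τ + t))) ∧ ‖T‖ ≤ 1 := fun t => by
    by_cases ht : 0 ≤ t
    · obtain ⟨T, hT⟩ := exists_clm_comp_add_right ht
        ((continuousOn_evolution hcontr hev hlip ht).aestronglyMeasurable measurableSet_Ici)
        fun τ hτ => hcontr τ (τ + t) hτ (by linarith)
      exact ⟨T, fun _ => hT⟩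
    · exact ⟨0, fun h => absurd h ht⟩
  choose 𝒮 h𝒮 using hex
  refine ⟨𝒮, fun t ht => (h𝒮 t ht).1, fun t ht => (h𝒮 t ht).2, ?_, fun s t hs ht => ?_,
    fun f => ?_⟩
  · ext1 f
    refine Lp.ext ?_
    filter_upwards [(h𝒮 0 le_rfl).1 f, ae_restrict_mem measurableSet_Ici] with τ h hτ
    rw [h, add_zero, hid τ hτ]
    rfl
  · ext1 f
    refine Lp.ext ?_
    filter_upwards [(h𝒮 (t + s) (by linarith)).1 f, (h𝒮 t ht).1 (𝒮 s f),
      (quasiMeasurePreserving_add_right_Ici ht).ae ((h𝒮 s hs).1 f),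
      ae_restrict_mem measurableSet_Ici] with τ h₁ h₂ h₃ hτ
    rw [ContinuousLinearMap.comp_apply, h₁, h₂, h₃, ← add_assoc,
      ← hev τ (τ + t) (τ + t + s) hτ (by linarith) (by linarith)]
    rfl
  · have hlim : Filter.Tendsto
        (fun t => (∫ τ in Set.Ici (0 : ℝ), ‖f (τ + t) - f τ‖) + C * t * ‖f‖)
        (nhdsWithin 0 (Set.Ioi 0)) (nhds 0) := by
      have h : Filter.Tendsto (fun t : ℝ => C * t * ‖f‖) (nhdsWithin 0 (Set.Ioi 0)) (nhds 0) := by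
        have : Continuous fun t : ℝ => C * t * ‖f‖ := by fun_prop
        simpa using (this.tendsto 0).mono_left nhdsWithin_le_nhds
      simpa using (tendsto_integral_norm_comp_add_right_sub f).add h
    refine squeeze_zero' (.of_forall fun t => norm_nonneg _) ?_ hlim
    filter_upwards [self_mem_nhdsWithin] with t (ht : 0 < t)
    have hf : Integrable f (volume.restrict (Set.Ici (0 : ℝ))) := L1.integrable_coeFn f
    have hft : Integrable (fun τ => f (τ + t)) (volume.restrict (Set.Ici (0 : ℝ))) :=
      (hf.mono_measure (map_add_right_Ici_le ht.le)).comp_measurable (measurable_add_const t)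
    have hsub : Integrable (fun τ => f (τ + t) - f τ) (volume.restrict (Set.Ici (0 : ℝ))) :=
      hft.sub hf
    rw [L1.norm_eq_integral_norm, L1.norm_eq_integral_norm, ← integral_const_mul,
      ← integral_add hsub.norm (hf.norm.const_mul _)]
    refine integral_mono_ae (L1.integrable_coeFn _).norm
      (hsub.norm.add (hf.norm.const_mul _)) ?_
    filter_upwards [Lp.coeFn_sub (𝒮 t f) f, (h𝒮 t ht.le).1 f,
      ae_restrict_mem measurableSet_Ici] with τ h₁ h₂ hτ
    have e : S τ (τ + t) (f (τ + t)) - f τ =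
        S τ (τ + t) (f (τ + t) - f τ) + (S τ (τ + t) - 1) (f τ) := by
      simp
    have h₃ := (S τ (τ + t)).le_of_opNorm_le
      (hcontr τ (τ + t) hτ (by linarith)) (f (τ + t) - f τ)
    have h₄ := (S τ (τ + t) - 1).le_of_opNorm_le
      (hlip τ (τ + t) hτ (by linarith)) (f τ)
    rw [one_mul] at h₃
    rw [add_sub_cancel_left] at h₄
    rw [h₁, Pi.sub_apply, h₂, e]
    exact (norm_add_le _ _).trans (add_le_add h₃ h₄)
end

section
/- Let U be a unitary operator on h⊗H, Ω ∈ H a unit vector, and T := T_U the vacuum expectation of U. Then for any two orthonormal bases {φ_k} and {ψ_k} of h and all v, w ∈ h, Σ_{k≥1} |⟨U(ψ_k,v)Ω, U(φ_k,w)Ω⟩ − conj(⟨ψ_k,v⟩)·⟨φ_k,w⟩| ≤ 4·‖T − 1‖·‖v‖·‖w‖. (This gives the trace-norm estimate ‖Z − Id‖₁ ≤ 4C(t−s) for the vacuum-reduced dynamics Z under the regularity assumption ‖T_{s,t} − 1‖ ≤ C(t−s).) -/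
/- STATEMENT 13: For a unitary U on h⊗H, unit vector Ω and vacuum expectation T,
for any two orthonormal bases {φ_k}, {ψ_k} of h and v, w ∈ h:
Σ_k |⟨U(ψ_k,v)Ω, U(φ_k,w)Ω⟩ − conj(⟨ψ_k,v⟩)·⟨φ_k,w⟩| ≤ 4‖T−1‖‖v‖‖w‖. -/

local notation "⟪" x ", " y "⟫" => @inner ℂ _ _ x y

/-- Cauchy–Schwarz for finite sums, with bounds on the square sums. -/
theorem Finset.sum_mul_le_of_sum_sq_le {ι : Type*} (s : Finset ι) (f g : ι → ℝ) {A B : ℝ}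
    (hA : 0 ≤ A) (hB : 0 ≤ B) (hf : ∑ i ∈ s, f i ^ 2 ≤ A ^ 2) (hg : ∑ i ∈ s, g i ^ 2 ≤ B ^ 2) :
    ∑ i ∈ s, f i * g i ≤ A * B :=
  (Real.sum_mul_le_sqrt_mul_sqrt s f g).trans <|
    mul_le_mul (Real.sqrt_le_iff.2 ⟨hA, hf⟩) (Real.sqrt_le_iff.2 ⟨hB, hg⟩) (Real.sqrt_nonneg _) hA

section TensorProduct

variable {h H E : Type*}
  [NormedAddCommGroup h] [InnerProductSpace ℂ h]
  [NormedAddCommGroup H] [InnerProductSpace ℂ H]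
  [NormedAddCommGroup E] [InnerProductSpace ℂ E]
  (tp : h →ₗ[ℂ] H →ₗ[ℂ] E)

/-- Bessel's inequality for the slices of a vector of a tensor product along an
orthonormal family of the first factor. -/
theorem sum_norm_sq_slice_le
    (htp : ∀ (u v : h) (ξ η : H), ⟪tp u ξ, tp v η⟫ = ⟪u, v⟫ * ⟪ξ, η⟫)
    {ι : Type*} {e : ι → h} (he : Orthonormal ℂ e) (x : E) (a : ι → H)
    (ha : ∀ k ξ, ⟪ξ, a k⟫ = ⟪tp (e k) ξ, x⟫) (s : Finset ι) :
    ∑ k ∈ s, ‖a k‖ ^ 2 ≤ ‖x‖ ^ 2 := by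
  classical
  set z : E := ∑ k ∈ s, tp (e k) (a k) with hz
  have hzx : ⟪z, x⟫ = ((∑ k ∈ s, ‖a k‖ ^ 2 : ℝ) : ℂ) := by
    rw [hz, sum_inner, Complex.ofReal_sum]
    refine Finset.sum_congr rfl fun k _ => ?_
    rw [← ha, inner_self_eq_norm_sq_to_K]
    push_cast
    rfl
  have hzz : ⟪z, z⟫ = ((∑ k ∈ s, ‖a k‖ ^ 2 : ℝ) : ℂ) := by
    conv_lhs => rw [hz]
    rw [sum_inner, Complex.ofReal_sum]
    refine Finset.sum_congr rfl fun k hk => ?_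
    rw [inner_sum, Finset.sum_eq_single_of_mem k hk]
    · rw [htp, inner_self_eq_norm_sq_to_K (a k), inner_self_eq_norm_sq_to_K (e k), he.1 k]
      push_cast
      simp
    · intro j _ hj
      rw [htp, he.2 hj.symm, zero_mul]
  have hz2 : ‖z‖ ^ 2 = ∑ k ∈ s, ‖a k‖ ^ 2 := by
    rw [← inner_self_eq_norm_sq (𝕜 := ℂ), hzz]
    exact Complex.ofReal_re _
  have hle : ‖z‖ ^ 2 ≤ ‖z‖ * ‖x‖ := by
    have := norm_inner_le_norm (𝕜 := ℂ) z x
    rw [hzx, ← hz2, Complex.norm_real, Real.norm_eq_abs] at this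
    exact (le_abs_self _).trans this
  rw [← hz2]
  nlinarith [sq_nonneg (‖z‖ - ‖x‖)]

theorem norm_tmul_of_norm_eq_one
    (htp : ∀ (u v : h) (ξ η : H), ⟪tp u ξ, tp v η⟫ = ⟪u, v⟫ * ⟪ξ, η⟫)
    (Ω : H) (hΩ : ‖Ω‖ = 1) (u : h) : ‖tp u Ω‖ = ‖u‖ := by
  have := htp u u Ω Ω
  simp only [inner_self_eq_norm_sq_to_K, hΩ] at this
  norm_num at this
  exact (sq_eq_sq₀ (norm_nonneg _) (norm_nonneg _)).1 (by exact_mod_cast this)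

/-- If `t` is the slice of `x` at the unit vector `Ω`, then `t ⊗ Ω` is the orthogonal
projection of `x` onto `h ⊗ Ω`, and Pythagoras' theorem holds. -/
theorem norm_sq_sub_tmul
    (htp : ∀ (u v : h) (ξ η : H), ⟪tp u ξ, tp v η⟫ = ⟪u, v⟫ * ⟪ξ, η⟫)
    (Ω : H) (hΩ : ‖Ω‖ = 1) (x : E) (t : h)
    (ht : ∀ u, ⟪u, t⟫ = ⟪tp u Ω, x⟫) :
    ‖x - tp t Ω‖ ^ 2 = ‖x‖ ^ 2 - ‖t‖ ^ 2 := by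
  have hre : RCLike.re ⟪x, tp t Ω⟫ = ‖t‖ ^ 2 := by
    rw [inner_re_symm, ← ht, inner_self_eq_norm_sq]
  rw [norm_sub_sq (𝕜 := ℂ), hre, norm_tmul_of_norm_eq_one tp htp Ω hΩ]
  ring

/-- The trace-norm estimate for vectors `x`, `y` of the tensor product whose slices at `Ω`
are `T v`, `T w`. -/
theorem sum_norm_slice_inner_sub_le
    (htp : ∀ (u v : h) (ξ η : H), ⟪tp u ξ, tp v η⟫ = ⟪u, v⟫ * ⟪ξ, η⟫)
    {ι : Type*} {φ ψ : ι → h}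
    (hφ : Orthonormal ℂ φ) (hψ : Orthonormal ℂ ψ) (Ω : H) (hΩ : ‖Ω‖ = 1)
    (T : h →L[ℂ] h) (v w : h) (x y : E) (hx : ‖x‖ = ‖v‖) (hy : ‖y‖ = ‖w‖)
    (hxT : ∀ u, ⟪u, T v⟫ = ⟪tp u Ω, x⟫) (hyT : ∀ u, ⟪u, T w⟫ = ⟪tp u Ω, y⟫)
    (a b : ι → H) (ha : ∀ k ξ, ⟪ξ, a k⟫ = ⟪tp (ψ k) ξ, x⟫)
    (hb : ∀ k ξ, ⟪ξ, b k⟫ = ⟪tp (φ k) ξ, y⟫) (s : Finset ι) :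
    ∑ k ∈ s, ‖⟪a k, b k⟫ - (starRingEnd ℂ) ⟪ψ k, v⟫ * ⟪φ k, w⟫‖
      ≤ 4 * ‖T - 1‖ * ‖v‖ * ‖w‖ := by
  have key : ∀ (e : ι → h), Orthonormal ℂ e → ∀ (u : h) (z : E), ‖z‖ = ‖u‖ →
      (∀ q, ⟪q, T u⟫ = ⟪tp q Ω, z⟫) → ∀ c : ι → H,
      (∀ k ξ, ⟪ξ, c k⟫ = ⟪tp (e k) ξ, z⟫) →
      ‖T u‖ ≤ ‖u‖ ∧
      ∑ k ∈ s, ‖c k - ⟪e k, T u⟫ • Ω‖ ^ 2 ≤ (√(2 * ‖T - 1‖) * ‖u‖) ^ 2 := by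
    intro e he u z hz hzT c hc
    have h1 := norm_sq_sub_tmul tp htp Ω hΩ z (T u) hzT
    have h2 : ‖T u‖ ≤ ‖u‖ := by
      rw [hz] at h1
      exact le_of_sq_le_sq (by nlinarith [sq_nonneg ‖z - tp (T u) Ω‖]) (norm_nonneg _)
    refine ⟨h2, (sum_norm_sq_slice_le tp htp he (z - tp (T u) Ω) _ ?_ s).trans ?_⟩
    · intro k ξ
      rw [inner_sub_right, inner_sub_right, hc, inner_smul_right, htp]
    · have h3 : ‖u‖ - ‖T u‖ ≤ ‖T - 1‖ * ‖u‖ := by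
        refine le_trans ?_ ((T - 1).le_opNorm u)
        rw [sub_apply, one_apply_eq_self, norm_sub_rev]
        exact norm_sub_norm_le _ _
      rw [h1, hz, mul_pow, Real.sq_sqrt (by positivity)]
      nlinarith [norm_nonneg (T u), norm_nonneg u,
        mul_le_mul_of_nonneg_right h3 (add_nonneg (norm_nonneg u) (norm_nonneg (T u))),
        mul_le_mul_of_nonneg_left h2 (mul_nonneg (norm_nonneg (T - 1)) (norm_nonneg u))]
  obtain ⟨-, hA⟩ := key ψ hψ v x hx hxT a ha
  obtain ⟨hTw, hB⟩ := key φ hφ w y hy hyT b hb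
  have bessel : ∀ (e : ι → h), Orthonormal ℂ e → ∀ u : h, ∀ C : ℝ, ‖u‖ ≤ C →
      ∑ k ∈ s, ‖⟪e k, u⟫‖ ^ 2 ≤ C ^ 2 := fun e he u C hC =>
    (he.sum_inner_products_le u).trans (pow_le_pow_left₀ (norm_nonneg _) hC 2)
  have S1 := Finset.sum_mul_le_of_sum_sq_le s _ _ (by positivity) (by positivity) hA hB
  have S2 := Finset.sum_mul_le_of_sum_sq_le s _ _ (by positivity) (by positivity)
    (bessel ψ hψ _ _ ((T - 1).le_opNorm v)) (bessel φ hφ _ _ hTw)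
  have S3 := Finset.sum_mul_le_of_sum_sq_le s _ _ (by positivity) (by positivity)
    (bessel ψ hψ v _ le_rfl) (bessel φ hφ _ _ ((T - 1).le_opNorm w))
  have hΩΩ : ⟪Ω, Ω⟫ = 1 := by
    rw [inner_self_eq_norm_sq_to_K, hΩ]
    norm_num
  have hpt : ∀ k ∈ s, ‖⟪a k, b k⟫ - (starRingEnd ℂ) ⟪ψ k, v⟫ * ⟪φ k, w⟫‖ ≤
      ‖a k - ⟪ψ k, T v⟫ • Ω‖ * ‖b k - ⟪φ k, T w⟫ • Ω‖ +
      ‖⟪ψ k, (T - 1) v⟫‖ * ‖⟪φ k, T w⟫‖ + ‖⟪ψ k, v⟫‖ * ‖⟪φ k, (T - 1) w⟫‖ := by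
    intro k _
    have hΩa : ⟪a k, Ω⟫ = (starRingEnd ℂ) ⟪ψ k, T v⟫ := by
      rw [← inner_conj_symm, ha, hxT]
    have hΩb : ⟪Ω, b k⟫ = ⟪φ k, T w⟫ := by
      rw [hb, hyT]
    have heq : ⟪a k, b k⟫ - (starRingEnd ℂ) ⟪ψ k, v⟫ * ⟪φ k, w⟫ =
        ⟪a k - ⟪ψ k, T v⟫ • Ω, b k - ⟪φ k, T w⟫ • Ω⟫ +
        (starRingEnd ℂ) ⟪ψ k, (T - 1) v⟫ * ⟪φ k, T w⟫ +
        (starRingEnd ℂ) ⟪ψ k, v⟫ * ⟪φ k, (T - 1) w⟫ := by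
      simp only [inner_sub_left, inner_sub_right, inner_smul_left, inner_smul_right, hΩa, hΩb,
        hΩΩ, sub_apply, one_apply_eq_self, map_sub]
      ring
    rw [heq]
    refine (norm_add₃_le).trans ?_
    rw [norm_mul, norm_mul, RCLike.norm_conj, RCLike.norm_conj]
    gcongr
    exact norm_inner_le_norm _ _
  refine (Finset.sum_le_sum hpt).trans ?_
  rw [Finset.sum_add_distrib, Finset.sum_add_distrib]
  have hsq : √(2 * ‖T - 1‖) * √(2 * ‖T - 1‖) = 2 * ‖T - 1‖ :=
    Real.mul_self_sqrt (by positivity)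
  calc _ ≤ √(2 * ‖T - 1‖) * ‖v‖ * (√(2 * ‖T - 1‖) * ‖w‖) + ‖T - 1‖ * ‖v‖ * ‖w‖ +
        ‖v‖ * (‖T - 1‖ * ‖w‖) := add_le_add (add_le_add S1 S2) S3
    _ = _ := by linear_combination ‖v‖ * ‖w‖ * hsq

end TensorProduct

theorem stmt13
    {h H E : Type*}
    [NormedAddCommGroup h] [InnerProductSpace ℂ h] [CompleteSpace h]
    [TopologicalSpace.SeparableSpace h]
    [NormedAddCommGroup H] [InnerProductSpace ℂ H] [CompleteSpace H]
    [TopologicalSpace.SeparableSpace H]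
    [NormedAddCommGroup E] [InnerProductSpace ℂ E] [CompleteSpace E]
    (tp : h →ₗ[ℂ] H →ₗ[ℂ] E)
    (htp : ∀ (u v : h) (ξ η : H), ⟪tp u ξ, tp v η⟫ = ⟪u, v⟫ * ⟪ξ, η⟫)
    (hdense : Dense (↑(Submodule.span ℂ (Set.range fun p : h × H => tp p.1 p.2)) : Set E))
    (op : (E →L[ℂ] E) → h → h → (H →L[ℂ] H))
    (hop : ∀ (M : E →L[ℂ] E) (u v : h) (ξ₁ ξ₂ : H),
      ⟪ξ₁, op M u v ξ₂⟫ = ⟪tp u ξ₁, M (tp v ξ₂)⟫)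
    (U : E →L[ℂ] E) (hU : U ∈ unitary (E →L[ℂ] E))
    (Ω : H) (hΩ : ‖Ω‖ = 1)
    (T : h →L[ℂ] h)
    (hT : ∀ u v : h, ⟪u, T v⟫ = ⟪tp u Ω, U (tp v Ω)⟫)
    (φ ψ : HilbertBasis ℕ ℂ h) (v w : h) :
    Summable (fun k : ℕ =>
      ‖⟪op U (ψ k) v Ω, op U (φ k) w Ω⟫ - (starRingEnd ℂ) ⟪ψ k, v⟫ * ⟪φ k, w⟫‖) ∧
    ∑' k : ℕ,
      ‖⟪op U (ψ k) v Ω, op U (φ k) w Ω⟫ - (starRingEnd ℂ) ⟪ψ k, v⟫ * ⟪φ k, w⟫‖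
        ≤ 4 * ‖T - 1‖ * ‖v‖ * ‖w‖ := by
  have hUn : ∀ z : E, ‖U z‖ = ‖z‖ := fun z =>
    ((Unitary.linearIsometryEquiv ⟨U, hU⟩).norm_map z)
  have htpΩ := norm_tmul_of_norm_eq_one tp htp Ω hΩ
  have hsum := sum_norm_slice_inner_sub_le tp htp φ.orthonormal ψ.orthonormal Ω hΩ T v w
    (U (tp v Ω)) (U (tp w Ω)) (by rw [hUn, htpΩ]) (by rw [hUn, htpΩ])
    (fun u => hT u v) (fun u => hT u w)
    (fun k => op U (ψ k) v Ω) (fun k => op U (φ k) w Ω)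
    (fun k ξ => hop U (ψ k) v ξ Ω) (fun k ξ => hop U (φ k) w ξ Ω)
  exact ⟨summable_of_sum_le (fun _ => norm_nonneg _) hsum,
    Real.tsum_le_of_sum_le (fun _ => norm_nonneg _) hsum⟩
end

section
/- Under Assumptions (A1), (A2'), (B) and (C, Gaussianity), for every s ≥ 0, every integer n ≥ 3, all u₁,...,u_n, v₁,...,v_n ∈ h and all ε₁,...,ε_n ∈ {0,1}: lim_{t↓s} (t−s)^{-1} ⟨Ω, [(U_{s,t}^{(ε₁)}−1)(u₁,v₁)]·[(U_{s,t}^{(ε₂)}−1)(u₂,v₂)]···[(U_{s,t}^{(ε_n)}−1)(u_n,v_n)] Ω⟩ = 0, where the product is taken in B(H) in the indicated order. -/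
/- STATEMENT 15: Under (A1), (A2'), (B) and the Gaussianity assumption (C)
(vanishing of third-order vacuum cumulants), all vacuum moments of order n ≥ 3
of the increments vanish at first order:
lim_{t↓s} (t−s)⁻¹ ⟨Ω, ∏_{k=1}^n (U_{s,t}^{(ε_k)}−1)(u_k,v_k) Ω⟩ = 0. -/

open Filter

local notation "⟪" x ", " y "⟫" => @inner ℂ _ _ x y

/-- `W^{(ε)}`: the operator itself for ε = 0 (`false`), its adjoint for ε = 1 (`true`). -/
noncomputable def epsPow {E : Type*} [NormedAddCommGroup E] [InnerProductSpace ℂ E]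
    [CompleteSpace E] (W : E →L[ℂ] E) (ε : Bool) : E →L[ℂ] E :=
  if ε then ContinuousLinearMap.adjoint W else W

section Unitary

variable {E : Type*} [NormedAddCommGroup E] [InnerProductSpace ℂ E] [CompleteSpace E]

theorem adjoint_epsPow_sub_one (W : E →L[ℂ] E) (ε : Bool) :
    ContinuousLinearMap.adjoint (epsPow W ε - 1) = epsPow W (!ε) - 1 := by
  have h1 : ContinuousLinearMap.adjoint (1 : E →L[ℂ] E) = 1 := by
    rw [← ContinuousLinearMap.star_eq_adjoint, star_one]
  cases ε <;> simp [epsPow, map_sub, h1]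

theorem norm_epsPow_apply {W : E →L[ℂ] E} (hW : W ∈ unitary (E →L[ℂ] E)) (ε : Bool) (x : E) :
    ‖epsPow W ε x‖ = ‖x‖ := by
  have key : ∀ V : E →L[ℂ] E, ContinuousLinearMap.adjoint V * V = 1 → ‖V x‖ = ‖x‖ := by
    intro V hV
    have h1 : ⟪V x, V x⟫ = ⟪x, x⟫ := by
      rw [← ContinuousLinearMap.adjoint_inner_right, ← mul_apply_eq_comp, hV,
        one_apply_eq_self]
    rw [inner_self_eq_norm_sq_to_K, inner_self_eq_norm_sq_to_K] at h1
    have h2 : ‖V x‖ ^ 2 = ‖x‖ ^ 2 := by exact_mod_cast h1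
    exact (sq_eq_sq₀ (norm_nonneg _) (norm_nonneg _)).mp h2
  cases ε
  · exact key W (Unitary.mem_iff.mp hW).1
  · refine key (ContinuousLinearMap.adjoint W) ?_
    rw [ContinuousLinearMap.adjoint_adjoint]
    exact (Unitary.mem_iff.mp hW).2

theorem norm_epsPow_sub_one_apply_sq {W : E →L[ℂ] E} (hW : W ∈ unitary (E →L[ℂ] E)) (ε : Bool)
    (x : E) : ‖(epsPow W ε - 1) x‖ ^ 2 = -2 * (⟪x, (W - 1) x⟫).re := by
  have h1 : (⟪epsPow W ε x, x⟫).re = (⟪x, W x⟫).re := by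
    cases ε
    · exact inner_re_symm (𝕜 := ℂ) _ _
    · simp [epsPow, ContinuousLinearMap.adjoint_inner_left]
  have h2 := norm_sub_sq (𝕜 := ℂ) (epsPow W ε x) x
  have h3 : (⟪x, x⟫).re = ‖x‖ ^ 2 := inner_self_eq_norm_sq (𝕜 := ℂ) x
  simp only [RCLike.re_to_complex] at h2
  rw [norm_epsPow_apply hW, h1] at h2
  simp only [sub_apply, one_apply_eq_self, inner_sub_right,
    Complex.sub_re, h2, h3]
  ring

end Unitary

section Slices

variable {h H E : Type*}
  [NormedAddCommGroup h] [InnerProductSpace ℂ h]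
  [NormedAddCommGroup H] [InnerProductSpace ℂ H]
  [NormedAddCommGroup E] [InnerProductSpace ℂ E]
  {tp : h →ₗ[ℂ] H →ₗ[ℂ] E} {op : (E →L[ℂ] E) → h → h → (H →L[ℂ] H)}

theorem norm_tp_apply (htp : ∀ (u v : h) (ξ η : H), ⟪tp u ξ, tp v η⟫ = ⟪u, v⟫ * ⟪ξ, η⟫)
    (u : h) (ξ : H) : ‖tp u ξ‖ = ‖u‖ * ‖ξ‖ := by
  have h1 := htp u u ξ ξ
  simp only [inner_self_eq_norm_sq_to_K] at h1
  have h2 : ‖tp u ξ‖ ^ 2 = (‖u‖ * ‖ξ‖) ^ 2 := by rw [mul_pow]; exact_mod_cast h1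
  exact (sq_eq_sq₀ (norm_nonneg _) (by positivity)).mp h2

theorem norm_op_apply_le (htp : ∀ (u v : h) (ξ η : H), ⟪tp u ξ, tp v η⟫ = ⟪u, v⟫ * ⟪ξ, η⟫)
    (hop : ∀ (M : E →L[ℂ] E) (u v : h) (ξ₁ ξ₂ : H),
      ⟪ξ₁, op M u v ξ₂⟫ = ⟪tp u ξ₁, M (tp v ξ₂)⟫)
    (M : E →L[ℂ] E) (u v : h) (ξ : H) : ‖op M u v ξ‖ ≤ ‖u‖ * ‖M (tp v ξ)‖ := by
  rcases (norm_nonneg (op M u v ξ)).eq_or_lt with h0 | h0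
  · rw [← h0]; positivity
  have h1 : ‖op M u v ξ‖ * ‖op M u v ξ‖ ≤ ‖u‖ * ‖op M u v ξ‖ * ‖M (tp v ξ)‖ := by
    rw [← norm_tp_apply htp, ← inner_self_eq_norm_mul_norm (𝕜 := ℂ) (op M u v ξ), hop]
    exact (RCLike.re_le_norm _).trans (norm_inner_le_norm _ _)
  nlinarith

variable [CompleteSpace E]

theorem inner_op_adjoint (hop : ∀ (M : E →L[ℂ] E) (u v : h) (ξ₁ ξ₂ : H),
      ⟪ξ₁, op M u v ξ₂⟫ = ⟪tp u ξ₁, M (tp v ξ₂)⟫)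
    (M : E →L[ℂ] E) (u v : h) (ξ η : H) :
    ⟪op M u v ξ, η⟫ = ⟪ξ, op (ContinuousLinearMap.adjoint M) v u η⟫ := by
  rw [hop, ContinuousLinearMap.adjoint_inner_right, ← inner_conj_symm, hop, inner_conj_symm]

theorem norm_inner_op_le (htp : ∀ (u v : h) (ξ η : H), ⟪tp u ξ, tp v η⟫ = ⟪u, v⟫ * ⟪ξ, η⟫)
    (hop : ∀ (M : E →L[ℂ] E) (u v : h) (ξ₁ ξ₂ : H),
      ⟪ξ₁, op M u v ξ₂⟫ = ⟪tp u ξ₁, M (tp v ξ₂)⟫)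
    (M : E →L[ℂ] E) (u v : h) (ξ η : H) :
    ‖⟪ξ, op M u v η⟫‖ ≤ ‖ContinuousLinearMap.adjoint M (tp u ξ)‖ * (‖v‖ * ‖η‖) := by
  rw [hop, ← ContinuousLinearMap.adjoint_inner_left, ← norm_tp_apply htp]
  exact norm_inner_le_norm _ _

theorem norm_op_epsPow_sub_one_apply_le
    (htp : ∀ (u v : h) (ξ η : H), ⟪tp u ξ, tp v η⟫ = ⟪u, v⟫ * ⟪ξ, η⟫)
    (hop : ∀ (M : E →L[ℂ] E) (u v : h) (ξ₁ ξ₂ : H),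
      ⟪ξ₁, op M u v ξ₂⟫ = ⟪tp u ξ₁, M (tp v ξ₂)⟫)
    {W : E →L[ℂ] E} (hW : W ∈ unitary (E →L[ℂ] E)) (ε : Bool) (u v : h) (ξ : H) :
    ‖op (epsPow W ε - 1) u v ξ‖ ≤ 2 * ‖u‖ * ‖v‖ * ‖ξ‖ := by
  refine (norm_op_apply_le htp hop _ u v ξ).trans ?_
  have h1 : ‖(epsPow W ε - 1) (tp v ξ)‖ ≤ 2 * (‖v‖ * ‖ξ‖) := by
    rw [← norm_tp_apply htp, two_mul]
    refine (norm_sub_le (epsPow W ε (tp v ξ)) (tp v ξ)).trans_eq ?_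
    rw [norm_epsPow_apply hW]
  calc ‖u‖ * ‖(epsPow W ε - 1) (tp v ξ)‖ ≤ ‖u‖ * (2 * (‖v‖ * ‖ξ‖)) := by gcongr
    _ = _ := by ring

/-- The squared norm of a product of two increments applied to `ξ` is controlled by a
third-order moment. -/
theorem norm_op_op_sq_le
    (htp : ∀ (u v : h) (ξ η : H), ⟪tp u ξ, tp v η⟫ = ⟪u, v⟫ * ⟪ξ, η⟫)
    (hop : ∀ (M : E →L[ℂ] E) (u v : h) (ξ₁ ξ₂ : H),
      ⟪ξ₁, op M u v ξ₂⟫ = ⟪tp u ξ₁, M (tp v ξ₂)⟫)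
    {W : E →L[ℂ] E} (hW : W ∈ unitary (E →L[ℂ] E)) (ε δ : Bool) (u v p w : h) (ξ : H) :
    ‖op (epsPow W ε - 1) u v (op (epsPow W δ - 1) p w ξ)‖ ^ 2 ≤
      2 * ‖u‖ ^ 2 * ‖⟪ξ, op (epsPow W (!δ) - 1) w p (op (epsPow W false - 1) v v
        (op (epsPow W δ - 1) p w ξ))⟫‖ := by
  set η := op (epsPow W δ - 1) p w ξ with hη
  have h1 := norm_op_apply_le htp hop (epsPow W ε - 1) u v η
  have h2 := norm_epsPow_sub_one_apply_sq hW ε (tp v η)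
  rw [← adjoint_epsPow_sub_one, ← inner_op_adjoint hop, ← hη, hop]
  change _ ≤ 2 * ‖u‖ ^ 2 * ‖⟪tp v η, (W - 1) (tp v η)⟫‖
  have h3 := (abs_le.mp (Complex.abs_re_le_norm ⟪tp v η, (W - 1) (tp v η)⟫)).1
  calc ‖op (epsPow W ε - 1) u v η‖ ^ 2 ≤ (‖u‖ * ‖(epsPow W ε - 1) (tp v η)‖) ^ 2 := by gcongr
    _ = ‖u‖ ^ 2 * (-2 * (⟪tp v η, (W - 1) (tp v η)⟫).re) := by rw [mul_pow, h2]
    _ ≤ ‖u‖ ^ 2 * (2 * ‖⟪tp v η, (W - 1) (tp v η)⟫‖) := by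
        have h4 : -2 * (⟪tp v η, (W - 1) (tp v η)⟫).re ≤ 2 * ‖⟪tp v η, (W - 1) (tp v η)⟫‖ := by
          linarith
        gcongr
    _ = _ := by ring

theorem norm_epsPow_sub_one_tp_sq_le
    (hop : ∀ (M : E →L[ℂ] E) (u v : h) (ξ₁ ξ₂ : H),
      ⟪ξ₁, op M u v ξ₂⟫ = ⟪tp u ξ₁, M (tp v ξ₂)⟫)
    {W : E →L[ℂ] E} (hW : W ∈ unitary (E →L[ℂ] E)) {Ω : H} {c : ℝ}
    (hc : ∀ u v : h, ‖u‖ = 1 → ‖v‖ = 1 → ‖⟪Ω, op (W - 1) u v Ω⟫‖ ≤ c) (ε : Bool) (v : h) :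
    ‖(epsPow W ε - 1) (tp v Ω)‖ ^ 2 ≤ 2 * ‖v‖ ^ 2 * c := by
  rcases eq_or_ne v 0 with rfl | hv
  · simp
  have hv' : ‖v‖ ≠ 0 := norm_ne_zero_iff.mpr hv
  set e : h := ((‖v‖⁻¹ : ℝ) : ℂ) • v with he
  have hen : ‖e‖ = 1 := by
    rw [he, norm_smul, Complex.norm_real, norm_inv, norm_norm, inv_mul_cancel₀ hv']
  have hve : v = ((‖v‖ : ℝ) : ℂ) • e := by
    rw [he, smul_smul, ← Complex.ofReal_mul, mul_inv_cancel₀ hv', Complex.ofReal_one, one_smul]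
  have h1 := hc e e hen hen
  rw [hop] at h1
  have h2 := norm_epsPow_sub_one_apply_sq hW ε (tp e Ω)
  have h3 := (abs_le.mp (Complex.abs_re_le_norm ⟪tp e Ω, (W - 1) (tp e Ω)⟫)).1
  have h4 : ‖(epsPow W ε - 1) (tp v Ω)‖ = ‖v‖ * ‖(epsPow W ε - 1) (tp e Ω)‖ := by
    conv_lhs => rw [hve]
    rw [map_smul, LinearMap.smul_apply, map_smul, norm_smul, Complex.norm_real, norm_norm]
  rw [h4, mul_pow, h2]
  calc ‖v‖ ^ 2 * (-2 * (⟪tp e Ω, (W - 1) (tp e Ω)⟫).re) ≤ ‖v‖ ^ 2 * (2 * c) := by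
        have h5 : -2 * (⟪tp e Ω, (W - 1) (tp e Ω)⟫).re ≤ 2 * c := by linarith
        gcongr
    _ = _ := by ring

end Slices

theorem stmt15
    {h H E : Type*}
    [NormedAddCommGroup h] [InnerProductSpace ℂ h] [CompleteSpace h]
    [TopologicalSpace.SeparableSpace h]
    [NormedAddCommGroup H] [InnerProductSpace ℂ H] [CompleteSpace H]
    [TopologicalSpace.SeparableSpace H]
    [NormedAddCommGroup E] [InnerProductSpace ℂ E] [CompleteSpace E]
    (tp : h →ₗ[ℂ] H →ₗ[ℂ] E)
    (htp : ∀ (u v : h) (ξ η : H), ⟪tp u ξ, tp v η⟫ = ⟪u, v⟫ * ⟪ξ, η⟫)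
    (hdense : Dense (↑(Submodule.span ℂ (Set.range fun p : h × H => tp p.1 p.2)) : Set E))
    (op : (E →L[ℂ] E) → h → h → (H →L[ℂ] H))
    (hop : ∀ (M : E →L[ℂ] E) (u v : h) (ξ₁ ξ₂ : H),
      ⟪ξ₁, op M u v ξ₂⟫ = ⟪tp u ξ₁, M (tp v ξ₂)⟫)
    (Ω : H) (hΩ : ‖Ω‖ = 1)
    (U : ℝ → ℝ → (E →L[ℂ] E))
    (hUunitary : ∀ s t : ℝ, 0 ≤ s → s ≤ t → U s t ∈ unitary (E →L[ℂ] E))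
    (hUid : ∀ s : ℝ, 0 ≤ s → U s s = 1)
    (hUev : ∀ r s t : ℝ, 0 ≤ r → r ≤ s → s ≤ t → U r s * U s t = U r t)
    (hA2 : ∀ s₁ t₁ s₂ t₂ : ℝ, 0 ≤ s₁ → s₁ ≤ t₁ → 0 ≤ s₂ → s₂ ≤ t₂ →
      Disjoint (Set.Ico s₁ t₁) (Set.Ico s₂ t₂) →
      ∀ u v p w : h,
        ⟪Ω, op (U s₁ t₁) u v (op (U s₂ t₂) p w Ω)⟫
          = ⟪Ω, op (U s₁ t₁) u v Ω⟫ * ⟪Ω, op (U s₂ t₂) p w Ω⟫)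
    (C : ℝ)
    (hB : ∀ s t : ℝ, 0 ≤ s → s ≤ t → ∀ u v : h, ‖u‖ = 1 → ‖v‖ = 1 →
      ‖⟪Ω, op (U s t - 1) u v Ω⟫‖ ≤ C * (t - s))
    -- (C) Gaussianity
    (hGauss : ∀ s : ℝ, 0 ≤ s → ∀ (ε₁ ε₂ ε₃ : Bool) (u₁ v₁ u₂ v₂ u₃ v₃ : h),
      Tendsto (fun t : ℝ => ((t - s : ℝ) : ℂ)⁻¹ *
          ⟪Ω, op (epsPow (U s t) ε₁ - 1) u₁ v₁
                (op (epsPow (U s t) ε₂ - 1) u₂ v₂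
                  (op (epsPow (U s t) ε₃ - 1) u₃ v₃ Ω))⟫)
        (nhdsWithin s (Set.Ioi s)) (nhds 0)) :
    ∀ s : ℝ, 0 ≤ s → ∀ n : ℕ, 3 ≤ n → ∀ (ε : Fin n → Bool) (u v : Fin n → h),
      Tendsto (fun t : ℝ => ((t - s : ℝ) : ℂ)⁻¹ *
          ⟪Ω, (List.ofFn fun i : Fin n => op (epsPow (U s t) (ε i) - 1) (u i) (v i)).prod Ω⟫)
        (nhdsWithin s (Set.Ioi s)) (nhds 0) := by
  intro s hs n hn ε u v
  have hpos : ∀ᶠ t in nhdsWithin s (Set.Ioi s), s < t := self_mem_nhdsWithin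
  have hprod : ∀ (m : ℕ) (ε : Fin (m + 2) → Bool) (u v : Fin (m + 2) → h),
      Tendsto (fun t : ℝ => (t - s)⁻¹ *
        ‖(List.ofFn fun i => op (epsPow (U s t) (ε i) - 1) (u i) (v i)).prod Ω‖ ^ 2)
        (nhdsWithin s (Set.Ioi s)) (nhds 0) := by
    intro m
    induction m with
    | zero =>
      intro ε u v
      have hG := ((hGauss s hs (!(ε 1)) false (ε 1) (v 1) (u 1) (v 0) (v 0) (u 1) (v 1)).norm).const_mul
        (2 * ‖u 0‖ ^ 2)
      rw [norm_zero, mul_zero] at hG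
      refine squeeze_zero' ?_ ?_ hG
      · filter_upwards [hpos] with t ht
        have : 0 < t - s := sub_pos.mpr ht
        positivity
      · filter_upwards [hpos] with t ht
        have hts : 0 < t - s := sub_pos.mpr ht
        have h1 := norm_op_op_sq_le htp hop (hUunitary s t hs ht.le) (ε 0) (ε 1)
          (u 0) (v 0) (u 1) (v 1) Ω
        have h2 := mul_le_mul_of_nonneg_left h1 (inv_nonneg.mpr hts.le)
        rw [norm_mul, norm_inv, Complex.norm_real, Real.norm_of_nonneg hts.le]
        simp only [List.ofFn_succ, List.ofFn_zero, List.prod_cons, List.prod_nil, mul_one,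
          mul_apply_eq_comp]
        refine h2.trans_eq ?_
        ring
    | succ m ih =>
      intro ε u v
      have hI := (ih (fun i => ε i.succ) (fun i => u i.succ) (fun i => v i.succ)).const_mul
        ((2 * ‖u 0‖ * ‖v 0‖) ^ 2)
      rw [mul_zero] at hI
      refine squeeze_zero' ?_ ?_ hI
      · filter_upwards [hpos] with t ht
        have : 0 < t - s := sub_pos.mpr ht
        positivity
      · filter_upwards [hpos] with t ht
        have hts : 0 < t - s := sub_pos.mpr ht
        rw [List.ofFn_succ, List.prod_cons, mul_apply_eq_comp]
        set ξ := (List.ofFn fun i : Fin (m + 2) =>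
          op (epsPow (U s t) (ε i.succ) - 1) (u i.succ) (v i.succ)).prod Ω
        have h1 := norm_op_epsPow_sub_one_apply_le htp hop (hUunitary s t hs ht.le) (ε 0)
          (u 0) (v 0) ξ
        calc (t - s)⁻¹ * ‖op (epsPow (U s t) (ε 0) - 1) (u 0) (v 0) ξ‖ ^ 2
            ≤ (t - s)⁻¹ * (2 * ‖u 0‖ * ‖v 0‖ * ‖ξ‖) ^ 2 := by gcongr
          _ = _ := by ring
  obtain ⟨m, rfl⟩ : ∃ m, n = m + 2 + 1 := ⟨n - 3, by omega⟩
  have hS := (((hprod m (fun i => ε i.succ) (fun i => u i.succ)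
    (fun i => v i.succ)).const_mul (2 * ‖u 0‖ ^ 2 * C * ‖v 0‖ ^ 2)).sqrt)
  rw [mul_zero, Real.sqrt_zero] at hS
  refine squeeze_zero_norm' ?_ hS
  filter_upwards [hpos] with t ht
  have hts : 0 < t - s := sub_pos.mpr ht
  refine Real.le_sqrt_of_sq_le ?_
  rw [List.ofFn_succ, List.prod_cons, mul_apply_eq_comp]
  set ξ := (List.ofFn fun i : Fin (m + 2) =>
    op (epsPow (U s t) (ε i.succ) - 1) (u i.succ) (v i.succ)).prod Ω
  have h1 := norm_inner_op_le htp hop (epsPow (U s t) (ε 0) - 1) (u 0) (v 0) Ω ξ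
  rw [adjoint_epsPow_sub_one] at h1
  have h2 := norm_epsPow_sub_one_tp_sq_le hop (hUunitary s t hs ht.le) (hB s t hs ht.le)
    (!(ε 0)) (u 0)
  rw [norm_mul, norm_inv, Complex.norm_real, Real.norm_of_nonneg hts.le]
  calc ((t - s)⁻¹ * ‖⟪Ω, op (epsPow (U s t) (ε 0) - 1) (u 0) (v 0) ξ⟫‖) ^ 2
      ≤ ((t - s)⁻¹ * (‖(epsPow (U s t) (!(ε 0)) - 1) (tp (u 0) Ω)‖ * (‖v 0‖ * ‖ξ‖))) ^ 2 := by
        gcongr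
    _ = ((t - s)⁻¹ * (‖v 0‖ * ‖ξ‖)) ^ 2 *
          ‖(epsPow (U s t) (!(ε 0)) - 1) (tp (u 0) Ω)‖ ^ 2 := by ring
    _ ≤ ((t - s)⁻¹ * (‖v 0‖ * ‖ξ‖)) ^ 2 * (2 * ‖u 0‖ ^ 2 * (C * (t - s))) := by gcongr
    _ = 2 * ‖u 0‖ ^ 2 * C * ‖v 0‖ ^ 2 * ((t - s)⁻¹ * ‖ξ‖ ^ 2) := by
        field_simp
end

section
/- Under Assumptions (A1), (A2'), (B) and (C, Gaussianity), let s ≥ 0 be a point at which the norm derivative G(s) := lim_{t↓s} (T_{s,t} − 1)/(t−s) exists in B(h) (this holds for almost every s). Then for all u, v, p, w ∈ h and every ε' ∈ {0,1}: lim_{t↓s} (t−s)^{-1} ⟨(U_{s,t} + U_{s,t}* − 2)(u,v)Ω, (U_{s,t}^{(ε')}−1)(p,w)Ω⟩ = 0. Equivalently, lim_{t↓s}(t−s)^{-1}⟨(U_{s,t}*−1)(u,v)Ω, (U_{s,t}^{(ε')}−1)(p,w)Ω⟩ = −lim_{t↓s}(t−s)^{-1}⟨(U_{s,t}−1)(u,v)Ω,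 (U_{s,t}^{(ε')}−1)(p,w)Ω⟩ whenever either limit exists. -/
/- STATEMENT 16: Under (A1), (A2'), (B), (C), at a point s where
G(s) = lim_{t↓s}(T_{s,t}−1)/(t−s) exists in norm:
lim_{t↓s}(t−s)⁻¹⟨(U_{s,t}+U_{s,t}*−2)(u,v)Ω, (U_{s,t}^{(ε')}−1)(p,w)Ω⟩ = 0,
equivalently the limits for (U*−1) and (U−1) in the first slot are negatives of
each other (whenever either exists). -/

open Filter

local notation "⟪" x ", " y "⟫" => @inner ℂ _ _ x y

section UnitaryIncrements

variable {E : Type*} [NormedAddCommGroup E] [InnerProductSpace ℂ E] [CompleteSpace E]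

theorem adjoint_epsPow (W : E →L[ℂ] E) (ε : Bool) :
    ContinuousLinearMap.adjoint (epsPow W ε) = epsPow W (!ε) := by
  cases ε <;> simp [epsPow]

theorem inner_sub_one_sub_one {W : E →L[ℂ] E} (hW : W ∈ unitary (E →L[ℂ] E)) (x y : E) :
    ⟪(W - 1) x, (W - 1) y⟫ = -⟪x, (W + ContinuousLinearMap.adjoint W - 2) y⟫ := by
  have hWW : ⟪W x, W y⟫ = ⟪x, y⟫ := by
    rw [← ContinuousLinearMap.adjoint_inner_right, ← mul_apply_eq_comp,
      ← ContinuousLinearMap.star_eq_adjoint, Unitary.star_mul_self_of_mem hW]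
    rfl
  have h2 : (2 : E →L[ℂ] E) y = y + y := by
    rw [← one_add_one_eq_two]; rfl
  simp only [sub_apply, add_apply, one_apply_eq_self, h2, inner_sub_left,
    inner_sub_right, inner_add_right, hWW, ContinuousLinearMap.adjoint_inner_right]
  ring

theorem norm_sub_one_apply_sq_le {W : E →L[ℂ] E} (hW : W ∈ unitary (E →L[ℂ] E)) (x : E) :
    ‖(W - 1) x‖ ^ 2 ≤ 2 * ‖⟪x, (W - 1) x⟫‖ := by
  have hsum : ⟪(W - 1) x, (W - 1) x⟫ = -(⟪x, (W - 1) x⟫ + ⟪(W - 1) x, x⟫) := by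
    have h2 : (2 : E →L[ℂ] E) x = x + x := by
      rw [← one_add_one_eq_two]; rfl
    rw [inner_sub_one_sub_one hW]
    simp only [sub_apply, add_apply, one_apply_eq_self, h2, inner_sub_left,
      inner_sub_right, inner_add_right, ContinuousLinearMap.adjoint_inner_right]
    ring
  calc ‖(W - 1) x‖ ^ 2 = ‖⟪(W - 1) x, (W - 1) x⟫‖ := by
        rw [inner_self_eq_norm_sq_to_K]; simp
    _ ≤ ‖⟪x, (W - 1) x⟫‖ + ‖⟪(W - 1) x, x⟫‖ := by
        rw [hsum, norm_neg]; exact norm_add_le _ _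
    _ = 2 * ‖⟪x, (W - 1) x⟫‖ := by
        rw [norm_inner_symm ((W - 1) x) x]; ring

end UnitaryIncrements

theorem tendsto_iff_of_add_tendsto_zero {α : Type*} {l : Filter α} {f g k : α → ℂ}
    (hk : Tendsto k l (nhds 0)) (hadd : ∀ a, k a = f a + g a) (L : ℂ) :
    Tendsto f l (nhds L) ↔ Tendsto g l (nhds (-L)) := by
  constructor
  · intro hf
    simpa [hadd] using hk.sub hf
  · intro hg
    simpa [hadd] using hk.sub hg

/-- The product of an `o(√τ)` and an `O(√τ)` quantity is `o(τ)`. -/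
theorem tendsto_inv_mul_zero_of_norm_le_mul {α : Type*} {l : Filter α} {τ a b : α → ℝ}
    {X : α → ℂ} {β : ℝ} (hτ : ∀ᶠ x in l, 0 < τ x) {A B : α → ℝ}
    (hX : ∀ᶠ x in l, ‖X x‖ ≤ a x * b x)
    (hA : ∀ᶠ x in l, a x ^ 2 ≤ τ x * A x) (hA0 : Tendsto A l (nhds 0))
    (hB : ∀ᶠ x in l, b x ^ 2 ≤ τ x * B x) (hBβ : Tendsto B l (nhds β)) :
    Tendsto (fun x => ((τ x : ℝ) : ℂ)⁻¹ * X x) l (nhds 0) := by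
  have hlim : Tendsto (fun x => √(A x) * √(B x)) l (nhds 0) := by
    simpa using hA0.sqrt.mul hBβ.sqrt
  refine squeeze_zero_norm' ?_ hlim
  filter_upwards [hτ, hX, hA, hB] with x hx hXx hAx hBx
  have hab : a x * b x ≤ τ x * (√(A x) * √(B x)) :=
    calc a x * b x ≤ √(τ x * A x) * √(τ x * B x) := by
          refine (le_abs_self _).trans ?_
          rw [abs_mul]
          exact mul_le_mul (Real.abs_le_sqrt hAx) (Real.abs_le_sqrt hBx) (abs_nonneg _)
            (Real.sqrt_nonneg _)
      _ = √(τ x) * √(τ x) * (√(A x) * √(B x)) := by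
          rw [Real.sqrt_mul hx.le, Real.sqrt_mul hx.le]; ring
      _ = τ x * (√(A x) * √(B x)) := by rw [Real.mul_self_sqrt hx.le]
  rw [norm_mul, norm_inv, Complex.norm_real, Real.norm_of_nonneg hx.le, inv_mul_le_iff₀ hx]
  exact hXx.trans hab

theorem stmt16
    {h H E : Type*}
    [NormedAddCommGroup h] [InnerProductSpace ℂ h] [CompleteSpace h]
    [TopologicalSpace.SeparableSpace h]
    [NormedAddCommGroup H] [InnerProductSpace ℂ H] [CompleteSpace H]
    [TopologicalSpace.SeparableSpace H]
    [NormedAddCommGroup E] [InnerProductSpace ℂ E] [CompleteSpace E]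
    (tp : h →ₗ[ℂ] H →ₗ[ℂ] E)
    (htp : ∀ (u v : h) (ξ η : H), ⟪tp u ξ, tp v η⟫ = ⟪u, v⟫ * ⟪ξ, η⟫)
    (hdense : Dense (↑(Submodule.span ℂ (Set.range fun p : h × H => tp p.1 p.2)) : Set E))
    (op : (E →L[ℂ] E) → h → h → (H →L[ℂ] H))
    (hop : ∀ (M : E →L[ℂ] E) (u v : h) (ξ₁ ξ₂ : H),
      ⟪ξ₁, op M u v ξ₂⟫ = ⟪tp u ξ₁, M (tp v ξ₂)⟫)
    (Ω : H) (hΩ : ‖Ω‖ = 1)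
    (U : ℝ → ℝ → (E →L[ℂ] E))
    (hUunitary : ∀ s t : ℝ, 0 ≤ s → s ≤ t → U s t ∈ unitary (E →L[ℂ] E))
    (hUid : ∀ s : ℝ, 0 ≤ s → U s s = 1)
    (hUev : ∀ r s t : ℝ, 0 ≤ r → r ≤ s → s ≤ t → U r s * U s t = U r t)
    (hA2 : ∀ s₁ t₁ s₂ t₂ : ℝ, 0 ≤ s₁ → s₁ ≤ t₁ → 0 ≤ s₂ → s₂ ≤ t₂ →
      Disjoint (Set.Ico s₁ t₁) (Set.Ico s₂ t₂) →
      ∀ u v p w : h,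
        ⟪Ω, op (U s₁ t₁) u v (op (U s₂ t₂) p w Ω)⟫
          = ⟪Ω, op (U s₁ t₁) u v Ω⟫ * ⟪Ω, op (U s₂ t₂) p w Ω⟫)
    (C : ℝ)
    (hB : ∀ s t : ℝ, 0 ≤ s → s ≤ t → ∀ u v : h, ‖u‖ = 1 → ‖v‖ = 1 →
      ‖⟪Ω, op (U s t - 1) u v Ω⟫‖ ≤ C * (t - s))
    (hGauss : ∀ s : ℝ, 0 ≤ s → ∀ (ε₁ ε₂ ε₃ : Bool) (u₁ v₁ u₂ v₂ u₃ v₃ : h),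
      Tendsto (fun t : ℝ => ((t - s : ℝ) : ℂ)⁻¹ *
          ⟪Ω, op (epsPow (U s t) ε₁ - 1) u₁ v₁
                (op (epsPow (U s t) ε₂ - 1) u₂ v₂
                  (op (epsPow (U s t) ε₃ - 1) u₃ v₃ Ω))⟫)
        (nhdsWithin s (Set.Ioi s)) (nhds 0))
    (T : ℝ → ℝ → (h →L[ℂ] h))
    (hT : ∀ s t : ℝ, 0 ≤ s → s ≤ t → ∀ u v : h,
      ⟪u, T s t v⟫ = ⟪tp u Ω, U s t (tp v Ω)⟫)
    (s : ℝ) (hs : 0 ≤ s) (Gs : h →L[ℂ] h)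
    (hGs : Tendsto (fun t : ℝ => (t - s)⁻¹ • (T s t - 1))
      (nhdsWithin s (Set.Ioi s)) (nhds Gs)) :
    ∀ (u v p w : h) (ε' : Bool),
      Tendsto (fun t : ℝ => ((t - s : ℝ) : ℂ)⁻¹ *
          ⟪op (U s t + ContinuousLinearMap.adjoint (U s t) - 2) u v Ω,
            op (epsPow (U s t) ε' - 1) p w Ω⟫)
        (nhdsWithin s (Set.Ioi s)) (nhds 0) ∧
      ∀ L : ℂ,
        Tendsto (fun t : ℝ => ((t - s : ℝ) : ℂ)⁻¹ *
            ⟪op (ContinuousLinearMap.adjoint (U s t) - 1) u v Ω,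
              op (epsPow (U s t) ε' - 1) p w Ω⟫)
          (nhdsWithin s (Set.Ioi s)) (nhds L)
        ↔ Tendsto (fun t : ℝ => ((t - s : ℝ) : ℂ)⁻¹ *
            ⟪op (U s t - 1) u v Ω, op (epsPow (U s t) ε' - 1) p w Ω⟫)
          (nhdsWithin s (Set.Ioi s)) (nhds (-L)) := by
  intro u v p w ε'
  have hτ : ∀ᶠ t in nhdsWithin s (Set.Ioi s), 0 < t - s :=
    eventually_nhdsWithin_of_forall fun t ht => sub_pos.mpr ht
  have hop' : ∀ (M : E →L[ℂ] E) (a b : h) (ξ₁ ξ₂ : H),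
      ⟪op M a b ξ₁, ξ₂⟫ = ⟪M (tp b ξ₁), tp a ξ₂⟫ := fun M a b ξ₁ ξ₂ => by
    rw [← inner_conj_symm, hop, inner_conj_symm]
  set ξ : ℝ → H := fun t => op (epsPow (U s t) ε' - 1) p w Ω with hξ
  have hinc : ∀ t, ⟪tp u (ξ t), (U s t - 1) (tp u (ξ t))⟫ =
      ⟪Ω, op (epsPow (U s t) (!ε') - 1) w p
        (op (epsPow (U s t) false - 1) u u (op (epsPow (U s t) ε' - 1) p w Ω))⟫ := fun t => by
    have hadj : epsPow (U s t) (!ε') - 1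
        = ContinuousLinearMap.adjoint (epsPow (U s t) ε' - 1) := by
      rw [map_sub, adjoint_epsPow, ← ContinuousLinearMap.star_eq_adjoint, star_one]
    rw [hop, hadj, ContinuousLinearMap.adjoint_inner_right, ← hop', hop]
    rfl
  have hvac : ∀ t, s ≤ t →
      ⟪tp v Ω, (U s t - 1) (tp v Ω)⟫ = ⟪v, (T s t - 1) v⟫ := fun t hst => by
    simp only [sub_apply, one_apply_eq_self, inner_sub_right, hT s t hs hst, htp,
      inner_self_eq_norm_sq_to_K, hΩ]
    simp
  have hmain : Tendsto (fun t : ℝ => ((t - s : ℝ) : ℂ)⁻¹ *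
      ⟪op (U s t + ContinuousLinearMap.adjoint (U s t) - 2) u v Ω, ξ t⟫)
      (nhdsWithin s (Set.Ioi s)) (nhds 0) := by
    refine tendsto_inv_mul_zero_of_norm_le_mul (β := 2 * ‖⟪v, Gs v⟫‖) hτ
      (a := fun t => ‖(U s t - 1) (tp u (ξ t))‖) (b := fun t => ‖(U s t - 1) (tp v Ω)‖)
      (A := fun t => 2 * ‖((t - s : ℝ) : ℂ)⁻¹ * ⟪tp u (ξ t), (U s t - 1) (tp u (ξ t))⟫‖)
      (B := fun t => 2 * ‖⟪v, ((t - s)⁻¹ • (T s t - 1)) v⟫‖) ?_ ?_ ?_ ?_ ?_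
    · filter_upwards [hτ] with t ht
      rw [norm_inner_symm, hop, ← norm_neg,
        ← inner_sub_one_sub_one (hUunitary s t hs (sub_pos.mp ht).le)]
      exact norm_inner_le_norm _ _
    · filter_upwards [hτ] with t ht
      refine (norm_sub_one_apply_sq_le (hUunitary s t hs (sub_pos.mp ht).le) _).trans_eq ?_
      rw [norm_mul, norm_inv, Complex.norm_real, Real.norm_of_nonneg ht.le]
      field_simp
    · simp only [hinc]
      simpa using (hGauss s hs (!ε') false ε' w p u u p w).norm.const_mul 2
    · filter_upwards [hτ] with t ht
      refine (norm_sub_one_apply_sq_le (hUunitary s t hs (sub_pos.mp ht).le) _).trans_eq ?_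
      rw [hvac t (sub_pos.mp ht).le, smul_apply, inner_smul_right_eq_smul, norm_smul, norm_inv,
        Real.norm_of_nonneg ht.le]
      field_simp
    · have hGv : Tendsto (fun t => ((t - s)⁻¹ • (T s t - 1)) v)
          (nhdsWithin s (Set.Ioi s)) (nhds (Gs v)) :=
        ((ContinuousLinearMap.apply ℂ h v).continuous.tendsto Gs).comp hGs
      exact ((tendsto_const_nhds.inner hGv).norm).const_mul 2
  refine ⟨hmain, tendsto_iff_of_add_tendsto_zero hmain fun t => ?_⟩
  have hsplit : U s t + ContinuousLinearMap.adjoint (U s t) - 2 =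
      (ContinuousLinearMap.adjoint (U s t) - 1) + (U s t - 1) := by
    rw [← one_add_one_eq_two]; abel
  rw [hop', hop', hop', hsplit, add_apply, inner_add_left, mul_add]
end

section
/- Under Assumptions (A1), (A2') and (B), let G : [0,∞) → B(h) be the measurable locally essentially bounded generator with T_{s,t} − 1 = ∫_s^t T_{s,τ}G(τ)dτ, and let s ≥ 0 be a point at which lim_{t↓s}(T_{s,t}−1)/(t−s) = G(s) in operator norm (almost every s). Then for every orthonormal basis {e_k : k ≥ 1} of h and every v ∈ h: lim_{t↓s} (t−s)^{-1} Σ_{k≥1} ‖(U_{s,t}−1)(e_k,v)Ω‖² = −2·Re⟨v, G(s)v⟩; in particular Re⟨v, G(s)v⟩ ≤ 0 for all v ∈ h. (This is the quantity ‖L(s)v‖² defining the noise coefficient L(s) : h → h⊗k_s.) -/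
/- STATEMENT 18: Under (A1), (A2') and (B), with G the measurable locally
essentially bounded generator of T_{s,t} and s a point where
(T_{s,t}−1)/(t−s) → G(s) in norm:
lim_{t↓s}(t−s)⁻¹ Σ_k ‖(U_{s,t}−1)(e_k,v)Ω‖² = −2 Re⟨v,G(s)v⟩, and in
particular Re⟨v,G(s)v⟩ ≤ 0. -/

open Filter MeasureTheory

local notation "⟪" x ", " y "⟫" => @inner ℂ _ _ x y

/-- The Parseval identity for the slices of a vector of a Hilbert space tensor product along an
orthonormal basis of the first factor. -/
theorem hasSum_norm_sq_slice {ι h H E : Type*}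
    [NormedAddCommGroup h] [InnerProductSpace ℂ h]
    [NormedAddCommGroup H] [InnerProductSpace ℂ H] [CompleteSpace H]
    [NormedAddCommGroup E] [InnerProductSpace ℂ E] [CompleteSpace E]
    (tp : h →ₗ[ℂ] H →ₗ[ℂ] E)
    (htp : ∀ (u v : h) (ξ η : H), ⟪tp u ξ, tp v η⟫ = ⟪u, v⟫ * ⟪ξ, η⟫)
    (hdense : Dense (↑(Submodule.span ℂ (Set.range fun p : h × H => tp p.1 p.2)) : Set E))
    (e : HilbertBasis ι ℂ h) (x : E) (y : ι → H)
    (hy : ∀ k ξ, ⟪ξ, y k⟫ = ⟪tp (e k) ξ, x⟫) :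
    HasSum (fun k => ‖y k‖ ^ 2) (‖x‖ ^ 2) := by
  classical
  have hnorm : ∀ u ξ, ‖tp u ξ‖ = ‖u‖ * ‖ξ‖ := fun u ξ => by
    have hsq : ‖tp u ξ‖ ^ 2 = (‖u‖ * ‖ξ‖) ^ 2 := by
      have hc := htp u u ξ ξ
      simp only [inner_self_eq_norm_sq_to_K] at hc
      rw [mul_pow]
      exact_mod_cast hc
    exact (sq_eq_sq₀ (norm_nonneg _) (by positivity)).1 hsq
  let V : ι → H →ₗᵢ[ℂ] E := fun k => ⟨tp (e k), fun ξ => by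
    rw [hnorm, e.orthonormal.1 k, one_mul]⟩
  have hV : OrthogonalFamily ℂ (fun _ : ι => H) V := fun i j hij ξ η => by
    change ⟪tp (e i) ξ, tp (e j) η⟫ = 0
    rw [htp, e.orthonormal.2 hij, zero_mul]
  have htop : ⊤ ≤ (⨆ k, LinearMap.range (V k).toLinearMap).topologicalClosure := by
    set K := (⨆ k, LinearMap.range (V k).toLinearMap).topologicalClosure
    have hmem : ∀ u ξ, tp u ξ ∈ K := fun u ξ => by
      let F : h →L[ℂ] E := (tp.flip ξ).mkContinuous ‖ξ‖ fun u => by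
        rw [LinearMap.flip_apply, hnorm, mul_comm]
      have hcl : IsClosed ((K.comap F.toLinearMap : Submodule ℂ h) : Set h) :=
        (Submodule.isClosed_topologicalClosure _).preimage F.continuous
      have hspan : Submodule.span ℂ (Set.range e) ≤ K.comap F.toLinearMap := by
        rw [Submodule.span_le]
        rintro _ ⟨k, rfl⟩
        exact Submodule.le_topologicalClosure _ (Submodule.mem_iSup_of_mem k ⟨ξ, rfl⟩)
      have hle := Submodule.topologicalClosure_minimal _ hspan hcl
      rw [e.dense_span] at hle
      exact hle (Submodule.mem_top (x := u))
    have hspan : Submodule.span ℂ (Set.range fun p : h × H => tp p.1 p.2) ≤ K := by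
      rw [Submodule.span_le]
      rintro _ ⟨p, rfl⟩
      exact hmem p.1 p.2
    have hle := Submodule.topologicalClosure_minimal _ hspan
      (Submodule.isClosed_topologicalClosure _)
    rwa [Submodule.dense_iff_topologicalClosure_eq_top.1 hdense] at hle
  have hS : IsHilbertSum ℂ (fun _ : ι => H) V := IsHilbertSum.mk hV htop
  have hcomp : ∀ k, hS.linearIsometryEquiv x k = y k := fun k => by
    refine ext_inner_left ℂ fun ξ => ?_
    rw [hy, ← lp.inner_single_left k ξ (hS.linearIsometryEquiv x),
      ← hS.linearIsometryEquiv.symm.inner_map_map, hS.linearIsometryEquiv_symm_apply_single,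
      LinearIsometryEquiv.symm_apply_apply]
    rfl
  have hsum := lp.hasSum_norm (p := 2) (by norm_num) (hS.linearIsometryEquiv x)
  simpa [hcomp] using hsum

theorem norm_sub_sq_of_mem_unitary {E : Type*}
    [NormedAddCommGroup E] [InnerProductSpace ℂ E] [CompleteSpace E]
    {W : E →L[ℂ] E} (hW : W ∈ unitary (E →L[ℂ] E)) (x : E) :
    ‖(W - 1) x‖ ^ 2 = -2 * (⟪x, (W - 1) x⟫).re := by
  have hWx : ‖W x‖ = ‖x‖ := (ContinuousLinearMap.norm_map_iff_adjoint_comp_self W).2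
    (Unitary.mem_iff.1 hW).1 x
  have hexp := norm_sub_sq (𝕜 := ℂ) (W x) x
  have hself : (⟪x, x⟫).re = ‖x‖ ^ 2 := inner_self_eq_norm_sq (𝕜 := ℂ) x
  have hsymm : RCLike.re ⟪W x, x⟫ = (⟪x, W x⟫).re := inner_re_symm (𝕜 := ℂ) _ _
  rw [sub_apply, one_apply_eq_self, inner_sub_right,
    Complex.sub_re, hexp, hself, hsymm, hWx]
  ring

theorem stmt18
    {h H E : Type*}
    [NormedAddCommGroup h] [InnerProductSpace ℂ h] [CompleteSpace h]
    [TopologicalSpace.SeparableSpace h]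
    [NormedAddCommGroup H] [InnerProductSpace ℂ H] [CompleteSpace H]
    [TopologicalSpace.SeparableSpace H]
    [NormedAddCommGroup E] [InnerProductSpace ℂ E] [CompleteSpace E]
    (tp : h →ₗ[ℂ] H →ₗ[ℂ] E)
    (htp : ∀ (u v : h) (ξ η : H), ⟪tp u ξ, tp v η⟫ = ⟪u, v⟫ * ⟪ξ, η⟫)
    (hdense : Dense (↑(Submodule.span ℂ (Set.range fun p : h × H => tp p.1 p.2)) : Set E))
    (op : (E →L[ℂ] E) → h → h → (H →L[ℂ] H))
    (hop : ∀ (M : E →L[ℂ] E) (u v : h) (ξ₁ ξ₂ : H),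
      ⟪ξ₁, op M u v ξ₂⟫ = ⟪tp u ξ₁, M (tp v ξ₂)⟫)
    (Ω : H) (hΩ : ‖Ω‖ = 1)
    (U : ℝ → ℝ → (E →L[ℂ] E))
    (hUunitary : ∀ s t : ℝ, 0 ≤ s → s ≤ t → U s t ∈ unitary (E →L[ℂ] E))
    (hUid : ∀ s : ℝ, 0 ≤ s → U s s = 1)
    (hUev : ∀ r s t : ℝ, 0 ≤ r → r ≤ s → s ≤ t → U r s * U s t = U r t)
    (hA2 : ∀ s₁ t₁ s₂ t₂ : ℝ, 0 ≤ s₁ → s₁ ≤ t₁ → 0 ≤ s₂ → s₂ ≤ t₂ →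
      Disjoint (Set.Ico s₁ t₁) (Set.Ico s₂ t₂) →
      ∀ u v p w : h,
        ⟪Ω, op (U s₁ t₁) u v (op (U s₂ t₂) p w Ω)⟫
          = ⟪Ω, op (U s₁ t₁) u v Ω⟫ * ⟪Ω, op (U s₂ t₂) p w Ω⟫)
    (C : ℝ)
    (hB : ∀ s t : ℝ, 0 ≤ s → s ≤ t → ∀ u v : h, ‖u‖ = 1 → ‖v‖ = 1 →
      ‖⟪Ω, op (U s t - 1) u v Ω⟫‖ ≤ C * (t - s))
    (T : ℝ → ℝ → (h →L[ℂ] h))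
    (hT : ∀ s t : ℝ, 0 ≤ s → s ≤ t → ∀ u v : h,
      ⟪u, T s t v⟫ = ⟪tp u Ω, U s t (tp v Ω)⟫)
    (G : ℝ → (h →L[ℂ] h))
    (hGmeas : AEStronglyMeasurable G (volume.restrict (Set.Ici (0 : ℝ))))
    (hGbdd : ∀ b : ℝ, 0 ≤ b → ∃ M : ℝ, ∀ᵐ t ∂(volume.restrict (Set.Icc (0 : ℝ) b)), ‖G t‖ ≤ M)
    (hGint : ∀ s t : ℝ, 0 ≤ s → s ≤ t → T s t - 1 = ∫ τ in s..t, (T s τ) ∘L (G τ))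
    (s : ℝ) (hs : 0 ≤ s)
    (hGs : Tendsto (fun t : ℝ => (t - s)⁻¹ • (T s t - 1))
      (nhdsWithin s (Set.Ioi s)) (nhds (G s)))
    (e : HilbertBasis ℕ ℂ h) (v : h) :
    Tendsto (fun t : ℝ => (t - s)⁻¹ * ∑' k : ℕ, ‖op (U s t - 1) (e k) v Ω‖ ^ 2)
        (nhdsWithin s (Set.Ioi s)) (nhds (-2 * (⟪v, G s v⟫).re)) ∧
    (⟪v, G s v⟫).re ≤ 0 := by
  have hlim : Tendsto (fun t : ℝ => (t - s)⁻¹ * ∑' k : ℕ, ‖op (U s t - 1) (e k) v Ω‖ ^ 2)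
      (nhdsWithin s (Set.Ioi s)) (nhds (-2 * (⟪v, G s v⟫).re)) := by
    have hcont : Continuous fun A : h →L[ℂ] h => -2 * (⟪v, A v⟫).re := by fun_prop
    refine ((hcont.tendsto (G s)).comp hGs).congr' ?_
    filter_upwards [self_mem_nhdsWithin] with t ht
    have hst : s ≤ t := le_of_lt ht
    have hΩΩ : ⟪Ω, Ω⟫ = 1 := inner_self_eq_one_of_norm_eq_one hΩ
    have hTU : ⟪v, (T s t - 1) v⟫ = ⟪tp v Ω, (U s t - 1) (tp v Ω)⟫ := by
      simp only [sub_apply, one_apply_eq_self, inner_sub_right,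
        hT s t hs hst, htp, hΩΩ, mul_one]
    rw [(hasSum_norm_sq_slice tp htp hdense e ((U s t - 1) (tp v Ω)) _
      fun k ξ => hop (U s t - 1) (e k) v ξ Ω).tsum_eq,
      norm_sub_sq_of_mem_unitary (hUunitary s t hs hst), ← hTU]
    simp only [Function.comp_apply, smul_apply]
    rw [inner_smul_right_eq_smul, Complex.smul_re, smul_eq_mul]
    ring
  refine ⟨hlim, ?_⟩
  have hnonneg : 0 ≤ -2 * (⟪v, G s v⟫).re := by
    refine ge_of_tendsto hlim ?_
    filter_upwards [self_mem_nhdsWithin] with t ht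
    exact mul_nonneg (inv_nonneg.2 (sub_nonneg.2 (le_of_lt ht)))
      (tsum_nonneg fun k => by positivity)
  linarith
end
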